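/- Let n ≥ 6 and let β be a partition of n which either has all parts ≥ 3, or equals [1, n−1] (one part 1 and one part n−1). Then every complex zero of the polynomial P_{[2,n−2],β}(x) has real part 0, i.e., all zeros of P_{[2,n−2],β} are purely imaginary. -/

import Mathlib

open Polynomial
open scoped Classical

/-- The cycle type of a permutation of `Fin n` as a partition of `n`,
including fixed points as parts equal to `1`. -/
noncomputable def fullCycleType {n : ℕ} (σ : Equiv.Perm (Fin n)) : Multiset ℕ :=
  σ.cycleType + Multiset.replicate (n - σ.cycleType.sum) 1

/-- The number of disjoint cycles of a permutation, fixed points included. -/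
noncomputable def numCycles {n : ℕ} (σ : Equiv.Perm (Fin n)) : ℕ :=
  Multiset.card (fullCycleType σ)

/-- The set (conjugacy class) of permutations of `Fin n` with full cycle type `β`. -/
noncomputable def permClass (n : ℕ) (β : Multiset ℕ) : Finset (Equiv.Perm (Fin n)) :=
  Finset.univ.filter (fun ω => fullCycleType ω = β)

/-- The polynomial `P_{[2,n-2],β}(x) = (n(n-1)/|C_β|) ⬝ Σ_{ρ(ω)=β} x^{κ(αω)}`. -/
noncomputable def Pperm {n : ℕ} (α : Equiv.Perm (Fin n)) (β : Multiset ℕ) : Polynomial ℚ :=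
  Polynomial.C (((n : ℚ) * ((n : ℚ) - 1)) / ((permClass n β).card : ℚ)) *
    ∑ ω ∈ permClass n β, Polynomial.X ^ (numCycles (α * ω))

/-- The polynomial `binom(x + c, k)` in `x`: for `k ≥ 0` it is
`(x+c)(x+c-1)⋯(x+c-k+1)/k!`, and it is `0` for `k < 0`. -/
noncomputable def binomPoly (c k : ℤ) : Polynomial ℚ :=
  if 0 ≤ k then
    (((k.toNat).factorial : ℚ))⁻¹ •
      ((descPochhammer ℚ k.toNat).comp (Polynomial.X + Polynomial.C (c : ℚ)))
  else 0

/-- The signless Stirling number of the first kind: the number of permutations of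
an `N`-element set with exactly `m` cycles (fixed points included). -/
noncomputable def stirling1 (N m : ℕ) : ℕ :=
  (Finset.univ.filter (fun σ : Equiv.Perm (Fin N) => numCycles σ = m)).card

/-- For a Young diagram with row lengths `L` (rows and columns 0-indexed),
the product `∏_{u} (t + c(u))` over the cells `u`, `c(u)` being the content. -/
def contentProd (L : List ℕ) (t : ℤ) : ℤ :=
  ∏ i ∈ Finset.range L.length, ∏ j ∈ Finset.range (L.getD i 0), (t + (j : ℤ) - (i : ℤ))

/-- `C(a, b)` for an integer `b`: the usual binomial coefficient when `b ≥ 0`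
(which is `0` for `b > a`), and `0` when `b < 0`. -/
def chooseZ (a : ℕ) (b : ℤ) : ℚ := if 0 ≤ b then (a.choose b.toNat : ℚ) else 0


section CycleCount

variable {V : Type*} [Fintype V] [DecidableEq V]

/-- The number of cycles, fixed points included, of a permutation of a finite type. -/
def cycleCount (σ : Equiv.Perm V) : ℕ :=
  Multiset.card σ.cycleType + (Fintype.card V - σ.support.card)

theorem numCycles_eq_cycleCount {n : ℕ} (σ : Equiv.Perm (Fin n)) : numCycles σ = cycleCount σ := by
  simp [numCycles, fullCycleType, cycleCount, Equiv.Perm.sum_cycleType]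

theorem cycleCount_conj (σ g : Equiv.Perm V) : cycleCount (g * σ * g⁻¹) = cycleCount σ := by
  simp [cycleCount, ← Equiv.Perm.sum_cycleType, Equiv.Perm.cycleType_conj]

theorem cycleType_permCongr {Y : Type*} [Fintype Y] [DecidableEq Y] (e : V ≃ Y)
    (σ : Equiv.Perm V) : (e.permCongr σ).cycleType = σ.cycleType := by
  have h := Equiv.Perm.cycleType_extendDomain (p := fun _ : Y => True)
    (e.trans (Equiv.subtypeUnivEquiv fun _ => trivial).symm) (g := σ)
  rw [← h]
  congr 1

theorem cycleCount_permCongr {Y : Type*} [Fintype Y] [DecidableEq Y] (e : V ≃ Y)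
    (σ : Equiv.Perm V) : cycleCount (e.permCongr σ) = cycleCount σ := by
  simp [cycleCount, ← Equiv.Perm.sum_cycleType, cycleType_permCongr, Fintype.card_congr e]

theorem cycleType_optionCongr (σ : Equiv.Perm V) :
    Equiv.Perm.cycleType (Equiv.optionCongr σ) = σ.cycleType := by
  have h := Equiv.Perm.cycleType_extendDomain (p := fun x : Option V => x.isSome)
    (Equiv.optionIsSomeEquiv V).symm (g := σ)
  rw [← h]
  congr 1
  ext1 x
  cases x with
  | none => rw [Equiv.Perm.extendDomain_apply_not_subtype _ _ (by simp)]; simp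
  | some x => rw [Equiv.Perm.extendDomain_apply_subtype _ _ (by simp)]; simp

theorem cycleCount_optionCongr (σ : Equiv.Perm V) :
    cycleCount (Equiv.optionCongr σ : Equiv.Perm (Option V)) = cycleCount σ + 1 := by
  have := σ.sum_cycleType_le
  simp only [cycleCount, ← Equiv.Perm.sum_cycleType, cycleType_optionCongr, Fintype.card_option]
  omega

theorem cycleCount_swap_mul {σ : Equiv.Perm V} {a : V} (h : σ a ≠ a) :
    cycleCount (Equiv.swap a (σ a) * σ) = cycleCount σ + 1 := by
  set c := σ.cycleOf a with hc
  set r := σ * c⁻¹ with hr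
  have hdis : r.Disjoint c := Equiv.Perm.disjoint_mul_inv_of_mem_cycleFactorsFinset
    (Equiv.Perm.cycleOf_mem_cycleFactorsFinset_iff.2 (Equiv.Perm.mem_support.2 h))
  have hcyc : c.IsCycle := Equiv.Perm.isCycle_cycleOf σ h
  have hca : c a = σ a := Equiv.Perm.cycleOf_apply_self σ a
  have hσ : σ = c * r := by rw [← hdis.commute.eq]; simp [hr]
  have hca' : c a ≠ a := by rwa [hca]
  have hmul : Equiv.swap a (σ a) * σ = (Equiv.swap a (c a) * c) * r := by
    rw [hca, mul_assoc, ← hσ]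
  have hle := σ.sum_cycleType_le
  have hσt : σ.cycleType = c.cycleType + r.cycleType := by
    conv_lhs => rw [hσ]
    exact hdis.symm.cycleType_mul
  rw [hcyc.cycleType] at hσt
  have hsum := congrArg Multiset.sum hσt
  have hcard := congrArg Multiset.card hσt
  simp only [Multiset.sum_add, Multiset.sum_singleton, Multiset.card_add,
    Multiset.card_singleton] at hsum hcard
  simp only [cycleCount, ← Equiv.Perm.sum_cycleType]
  by_cases h2 : c (c a) = a
  · have hsw : c = Equiv.swap a (c a) := Equiv.Perm.IsCycle.eq_swap_of_apply_apply_eq_self hcyc hca' h2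
    have hone : Equiv.swap a (c a) * c = 1 := by
      conv_lhs => rw [hsw]
      simp
    have h2c : c.support.card = 2 := by
      rw [hsw]; exact Equiv.Perm.card_support_swap (Ne.symm (by simpa using hca'))
    rw [hmul, hone, one_mul]
    omega
  · have hcyc' := hcyc.swap_mul hca' h2
    have hsupp := Equiv.Perm.support_swap_mul_eq c a h2
    have hdis' : (Equiv.swap a (c a) * c).Disjoint r := by
      rw [Equiv.Perm.disjoint_iff_disjoint_support, hsupp]
      exact (Equiv.Perm.disjoint_iff_disjoint_support.1 hdis.symm).mono_left sdiff_le
    have ha : a ∈ c.support := Equiv.Perm.mem_support.2 hca'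
    have hcs : (Equiv.swap a (c a) * c).support.card = c.support.card - 1 := by
      rw [hsupp, Finset.card_sdiff_of_subset (by simpa using hca')]; simp
    have hpos : 0 < c.support.card := Finset.card_pos.2 ⟨a, ha⟩
    rw [hmul, hdis'.cycleType_mul, hcyc'.cycleType, hcs]
    simp only [Multiset.sum_add, Multiset.sum_singleton, Multiset.card_add,
      Multiset.card_singleton]
    omega

theorem cycleCount_removeNone (σ : Equiv.Perm (Option V)) :
    cycleCount σ = cycleCount (Equiv.removeNone σ) + if σ none = none then 1 else 0 := by
  have h := map_equiv_removeNone σ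
  have h1 := cycleCount_optionCongr (Equiv.removeNone σ)
  rw [h] at h1
  split_ifs with h0
  · rw [← h1, h0, Equiv.swap_self]; rfl
  · rw [cycleCount_swap_mul h0] at h1
    omega

theorem cycleCount_pos [Nonempty V] (σ : Equiv.Perm V) : 0 < cycleCount σ := by
  unfold cycleCount
  by_contra h
  have h1 : Multiset.card σ.cycleType = 0 := by omega
  rw [Equiv.Perm.card_cycleType_eq_zero] at h1
  subst h1
  have := Fintype.card_pos (α := V)
  simp at h

omit [Fintype V] in
theorem removeNone_mul_optionCongr (θ : Equiv.Perm (Option V)) (γ : Equiv.Perm V) :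
    Equiv.removeNone (θ * Equiv.optionCongr γ) = Equiv.removeNone θ * γ := by
  apply Equiv.optionCongr_injective
  rw [map_equiv_removeNone]
  have : Equiv.optionCongr (Equiv.removeNone θ * γ)
      = Equiv.optionCongr (Equiv.removeNone θ) * Equiv.optionCongr γ := by
    ext1 x; cases x <;> simp [-map_equiv_removeNone]
  rw [this, map_equiv_removeNone]
  simp [mul_assoc]

theorem cycleType_eq_of_cycleCount_eq_one {σ : Equiv.Perm V} (hX : 2 ≤ Fintype.card V)
    (h : cycleCount σ = 1) : σ.cycleType = {Fintype.card V} := by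
  have hle := σ.sum_cycleType_le
  simp only [cycleCount, ← Equiv.Perm.sum_cycleType] at h
  have h0 : Multiset.card σ.cycleType ≠ 0 := by
    intro h0
    rw [Equiv.Perm.card_cycleType_eq_zero] at h0
    subst h0
    simp at h
    omega
  have h1 : Multiset.card σ.cycleType = 1 := by omega
  obtain ⟨k, hk⟩ := Multiset.card_eq_one.1 h1
  rw [hk] at h hle ⊢
  simp at h hle ⊢
  omega

end CycleCount

section WeightedDet

variable {V : Type*} [Fintype V] [DecidableEq V]

/-- The matrix `1 - diag(w) M` where `M` is the permutation matrix of `θ`. -/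
noncomputable def weightMatrix (w : V → ℂ[X]) (θ : Equiv.Perm V) : Matrix V V ℂ[X] :=
  Matrix.of fun i j => (if i = j then 1 else 0) - w i * (if θ i = j then 1 else 0)

/-- The product over the cycles of `θ` of `1` minus the product of the weights in the cycle. -/
noncomputable def weightDet (w : V → ℂ[X]) (θ : Equiv.Perm V) : ℂ[X] :=
  (weightMatrix w θ).det

/-- The polynomial `∏ (1 - X ^ ℓ)` over the cycle lengths `ℓ` of `θ`. -/
noncomputable def cyclePoly (θ : Equiv.Perm V) : ℂ[X] :=
  weightDet (fun _ => Polynomial.X) θ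

theorem weightDet_permCongr {Y : Type*} [Fintype Y] [DecidableEq Y] (e : V ≃ Y)
    (w : V → ℂ[X]) (θ : Equiv.Perm V) :
    weightDet (w ∘ e.symm) (e.permCongr θ) = weightDet w θ := by
  unfold weightDet
  rw [← Matrix.det_submatrix_equiv_self e]
  congr 1
  ext1 i j
  simp [weightMatrix]

theorem weightDet_eq_zero {w : V → ℂ[X]} {θ : Equiv.Perm V} {a : V} (h : θ a = a) (hw : w a = 1) :
    weightDet w θ = 0 := by
  apply Matrix.det_eq_zero_of_row_eq_zero a
  intro j
  simp [weightMatrix, h, hw]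

theorem weightDet_removeNone {w : Option V → ℂ[X]} {θ : Equiv.Perm (Option V)}
    (h : θ none ≠ none) (hw : w none = 1) :
    weightDet w θ = weightDet (fun x => w (some x)) (Equiv.removeNone θ) := by
  unfold weightDet
  rw [← Matrix.det_submatrix_equiv_self (Equiv.optionEquivSumPUnit.{0} V).symm,
    ← Matrix.fromBlocks_toBlocks (Matrix.submatrix _ _ _)]
  have h22 : (Matrix.submatrix (weightMatrix w θ) (Equiv.optionEquivSumPUnit.{0} V).symm
      (Equiv.optionEquivSumPUnit.{0} V).symm).toBlocks₂₂ = 1 := by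
    ext1 i j
    simp [weightMatrix, Matrix.toBlocks₂₂, h]
  rw [h22, Matrix.det_fromBlocks_one₂₂]
  congr 1
  ext1 i j
  simp only [Matrix.toBlocks₁₁, Matrix.toBlocks₁₂, Matrix.toBlocks₂₁, weightMatrix,
    Matrix.sub_apply, Matrix.mul_apply, Matrix.of_apply, Matrix.submatrix_apply]
  rcases hi : θ (some i) with _ | k
  · have := Equiv.removeNone_none θ hi
    simp only [Finset.univ_unique, Finset.sum_singleton]
    by_cases hij : Equiv.removeNone θ i = j <;> simp [hi, ← this, hij, hw]
  · have := Equiv.removeNone_some θ ⟨k, hi⟩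
    rw [hi] at this
    have hk := Option.some_injective _ this
    simp [hi, hk]

theorem derivative_det (A : Matrix V V ℂ[X]) :
    derivative A.det = ∑ a, (A.updateRow a fun j => derivative (A a j)).det := by
  rw [← Matrix.det_transpose A, Matrix.det_apply, Polynomial.derivative_sum]
  have : ∀ a, (A.updateRow a fun j => derivative (A a j)).det =
      ∑ σ : Equiv.Perm V, Equiv.Perm.sign σ •
        ((∏ i ∈ Finset.univ.erase a, A i (σ i)) * derivative (A a (σ a))) := by
    intro a
    rw [← Matrix.det_transpose, Matrix.det_apply]
    refine Finset.sum_congr rfl fun σ _ => ?_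
    rw [← Finset.prod_erase_mul _ _ (Finset.mem_univ a)]
    congr 2
    · refine Finset.prod_congr rfl fun i hi => ?_
      simp [Matrix.updateRow_ne (Finset.ne_of_mem_erase hi)]
    · simp
  rw [Finset.sum_congr rfl fun a _ => this a, Finset.sum_comm]
  refine Finset.sum_congr rfl fun σ _ => ?_
  rw [← Finset.smul_sum]
  rcases Int.units_eq_one_or (Equiv.Perm.sign σ) with h | h <;>
    simp [h, Polynomial.derivative_prod_finset]

end WeightedDet

section TwoRows

variable {V R : Type*} [Fintype V] [DecidableEq V] [CommRing R]

/-- The determinant of `A` with row `a` replaced by `v` and row `b` replaced by `w`. -/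
def twoRowDet (A : Matrix V V R) (a b : V) (v w : V → R) : R :=
  ((A.updateRow a v).updateRow b w).det

variable {A : Matrix V V R} {a b : V}

omit [Fintype V] [CommRing R] in
theorem updateRow_comm (hab : a ≠ b) (v w : V → R) :
    (A.updateRow a v).updateRow b w = (A.updateRow b w).updateRow a v := by
  ext i j
  rcases eq_or_ne i a with rfl | hi
  · simp [Matrix.updateRow_ne hab]
  · rcases eq_or_ne i b with rfl | hi'
    · simp [Matrix.updateRow_ne, hi]
    · simp [Matrix.updateRow_ne, hi, hi']

theorem twoRowDet_add_right (v w w' : V → R) :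
    twoRowDet A a b v (w + w') = twoRowDet A a b v w + twoRowDet A a b v w' :=
  Matrix.det_updateRow_add _ _ _ _

theorem twoRowDet_smul_right (c : R) (v w : V → R) :
    twoRowDet A a b v (c • w) = c * twoRowDet A a b v w :=
  Matrix.det_updateRow_smul _ _ _ _

theorem twoRowDet_add_left (hab : a ≠ b) (v v' w : V → R) :
    twoRowDet A a b (v + v') w = twoRowDet A a b v w + twoRowDet A a b v' w := by
  simp only [twoRowDet, updateRow_comm hab, Matrix.det_updateRow_add]

theorem twoRowDet_smul_left (hab : a ≠ b) (c : R) (v w : V → R) :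
    twoRowDet A a b (c • v) w = c * twoRowDet A a b v w := by
  simp only [twoRowDet, updateRow_comm hab, Matrix.det_updateRow_smul]

theorem twoRowDet_self (hab : a ≠ b) (v : V → R) : twoRowDet A a b v v = 0 :=
  Matrix.det_zero_of_row_eq hab (by simp [Matrix.updateRow_ne hab])

theorem twoRowDet_swap (hab : a ≠ b) (v w : V → R) :
    twoRowDet A a b v w = -twoRowDet A a b w v := by
  have h := twoRowDet_self (A := A) hab (v + w)
  rw [twoRowDet_add_left hab, twoRowDet_add_right, twoRowDet_add_right, twoRowDet_self hab,
    twoRowDet_self hab] at h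
  linear_combination h

theorem twoRowDet_row_left (w : V → R) :
    twoRowDet A a b (A a) w = (A.updateRow b w).det := by
  rw [twoRowDet, Matrix.updateRow_eq_self]

theorem twoRowDet_row_right (hab : a ≠ b) (v : V → R) :
    twoRowDet A a b v (A b) = (A.updateRow a v).det := by
  rw [twoRowDet, updateRow_comm hab, Matrix.updateRow_eq_self]

end TwoRows

section PairSums

variable {V : Type*} [Fintype V] [DecidableEq V] (θ : Equiv.Perm V)

/-- The matrix `1 - t M` where `M` is the permutation matrix of `θ`. -/
noncomputable abbrev cycleMatrix : Matrix V V ℂ[X] := weightMatrix (fun _ => Polynomial.X) θ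

omit [Fintype V] in
theorem cycleMatrix_row (a : V) :
    cycleMatrix θ a = Pi.single a 1 - (Polynomial.X : ℂ[X]) • Pi.single (θ a) 1 := by
  ext1 j
  simp [cycleMatrix, weightMatrix, Pi.single_apply, eq_comm]

theorem X_mul_det_updateRow_one (a : V) :
    Polynomial.X * weightDet (Function.update (fun _ => Polynomial.X) a 1) θ =
      (Polynomial.X - 1) * (cycleMatrix θ).adjugate a a + cyclePoly θ := by
  have h : weightMatrix (Function.update (fun _ => Polynomial.X) a 1) θ =
      (cycleMatrix θ).updateRow a (Pi.single a 1 - Pi.single (θ a) 1) := by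
    ext1 i j
    rcases eq_or_ne i a with rfl | hi
    · simp [weightMatrix, Pi.single_apply, eq_comm]
    · simp [weightMatrix, hi, Matrix.updateRow_ne]
  rw [weightDet, h, ← Matrix.det_updateRow_smul]
  have : (Polynomial.X : ℂ[X]) • (Pi.single a 1 - Pi.single (θ a) 1 : V → ℂ[X]) =
      (Polynomial.X - 1 : ℂ[X]) • Pi.single a 1 + cycleMatrix θ a := by
    rw [cycleMatrix_row]
    module
  rw [this, Matrix.det_updateRow_add, Matrix.det_updateRow_smul, Matrix.updateRow_eq_self,
    Matrix.adjugate_apply]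
  rfl

omit [Fintype V] in
theorem X_smul_derivative_row (a : V) :
    (Polynomial.X : ℂ[X]) • (fun j => derivative (cycleMatrix θ a j)) =
      cycleMatrix θ a + (-1 : ℂ[X]) • Pi.single a 1 := by
  rw [cycleMatrix_row]
  ext1 j
  simp [Pi.single_apply, apply_ite derivative]
  ring

theorem trace_adjugate_cycleMatrix :
    ∑ a, (cycleMatrix θ).adjugate a a =
      (Fintype.card V : ℂ[X]) * cyclePoly θ - Polynomial.X * derivative (cyclePoly θ) := by
  have h : Polynomial.X * derivative (cyclePoly θ) =
      ∑ a, (cyclePoly θ - (cycleMatrix θ).adjugate a a) := by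
    rw [cyclePoly, weightDet, derivative_det, Finset.mul_sum]
    refine Finset.sum_congr rfl fun a _ => ?_
    rw [← Matrix.det_updateRow_smul, X_smul_derivative_row, Matrix.det_updateRow_add, Matrix.det_updateRow_smul,
      Matrix.updateRow_eq_self, Matrix.adjugate_apply]
    ring
  rw [h, Finset.sum_sub_distrib]
  simp

theorem X_mul_sum_weightDet_one :
    ∑ a, weightDet (Function.update (fun _ => Polynomial.X) a 1) θ =
      (Fintype.card V : ℂ[X]) * cyclePoly θ + (1 - Polynomial.X) * derivative (cyclePoly θ) := by
  refine mul_left_cancel₀ Polynomial.X_ne_zero ?_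
  rw [Finset.mul_sum, Finset.sum_congr rfl fun a _ => X_mul_det_updateRow_one θ a,
    Finset.sum_add_distrib, ← Finset.mul_sum, trace_adjugate_cycleMatrix]
  simp only [Finset.sum_const, Finset.card_univ, nsmul_eq_mul]
  ring

theorem sum_twoRowDet_single :
    ∑ a, ∑ b ∈ Finset.univ.erase a,
        twoRowDet (cycleMatrix θ) a b (Pi.single a 1) (Pi.single b 1) =
      Polynomial.X ^ 2 * derivative (derivative (cyclePoly θ)) -
        (Fintype.card V : ℂ[X]) * (Fintype.card V - 1 : ℂ[X]) * cyclePoly θ +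
        2 * (Fintype.card V - 1 : ℂ[X]) * ∑ a, (cycleMatrix θ).adjugate a a := by
  have hcard (a : V) : ((Finset.univ.erase a).card : ℂ[X]) = Fintype.card V - 1 := by
    rw [Finset.card_erase_of_mem (Finset.mem_univ a), Finset.card_univ,
      Nat.cast_pred (Fintype.card_pos_iff.2 ⟨a⟩)]
  have h (a : V) : Polynomial.X * derivative ((cycleMatrix θ).adjugate a a) =
      ∑ b ∈ Finset.univ.erase a, ((cycleMatrix θ).adjugate a a -
        twoRowDet (cycleMatrix θ) a b (Pi.single a 1) (Pi.single b 1)) := by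
    rw [Matrix.adjugate_apply, derivative_det, ← Finset.add_sum_erase _ _ (Finset.mem_univ a),
      Matrix.det_eq_zero_of_row_eq_zero a (fun j => by simp [Pi.single_apply, apply_ite derivative]),
      zero_add, Finset.mul_sum]
    refine Finset.sum_congr rfl fun b hb => ?_
    have hab := Finset.ne_of_mem_erase hb
    simp only [Matrix.updateRow_ne hab]
    rw [← Matrix.det_updateRow_smul, X_smul_derivative_row, Matrix.det_updateRow_add,
      Matrix.det_updateRow_smul, twoRowDet, ← Matrix.updateRow_ne (M := cycleMatrix θ) hab,
      Matrix.updateRow_eq_self]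
    ring
  have hT := congrArg (fun p => Polynomial.X * derivative p) (trace_adjugate_cycleMatrix θ)
  simp only [Polynomial.derivative_sum, Finset.mul_sum, h, Finset.sum_sub_distrib,
    Finset.sum_const, nsmul_eq_mul, hcard] at hT
  rw [← Finset.mul_sum] at hT
  simp only [Polynomial.derivative_sub, Polynomial.derivative_mul, Polynomial.derivative_natCast,
    Polynomial.derivative_X] at hT
  linear_combination -hT - (Fintype.card V - 1 : ℂ[X]) * trace_adjugate_cycleMatrix θ

theorem exists_cyclePoly_quotient [Nonempty V] :
    ∃ K : ℂ[X], (1 - Polynomial.X) * K = cyclePoly θ ∧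
      ∑ a, ∑ b, (cycleMatrix θ).adjugate a b = (Fintype.card V : ℂ[X]) * K := by
  have h (b : V) : (1 - Polynomial.X) * ∑ a, (cycleMatrix θ).adjugate a b = cyclePoly θ := by
    have h1 : Matrix.vecMul (fun _ : V => (1 : ℂ[X])) (cycleMatrix θ) =
        fun _ => (1 - Polynomial.X : ℂ[X]) := by
      ext1 j
      simp [Matrix.vecMul, dotProduct, cycleMatrix, weightMatrix, Finset.sum_sub_distrib,
        ← Equiv.eq_symm_apply]
    have h2 := congrArg (fun v => Matrix.vecMul v (cycleMatrix θ).adjugate b) h1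
    simp only [Matrix.vecMul_vecMul, Matrix.mul_adjugate] at h2
    simpa [Matrix.vecMul, dotProduct, Matrix.smul_apply, Matrix.one_apply, ← Finset.mul_sum,
      cyclePoly, weightDet] using h2.symm
  have hne : (1 - Polynomial.X : ℂ[X]) ≠ 0 := by
    intro h0
    simpa using congrArg (Polynomial.eval 0) h0
  obtain ⟨c⟩ := ‹Nonempty V›
  refine ⟨∑ a, (cycleMatrix θ).adjugate a c, h c, ?_⟩
  refine Finset.sum_comm.trans ?_
  rw [Finset.sum_congr rfl fun b _ => mul_left_cancel₀ hne ((h b).trans (h c).symm)]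
  simp only [Finset.sum_const, Finset.card_univ, nsmul_eq_mul]

end PairSums

section PairSums

variable {V : Type*} [Fintype V] [DecidableEq V] (θ : Equiv.Perm V)

/-- The weights `u` at `a`, `v` at `b` and `X` elsewhere. -/
noncomputable def pairWeight (a b : V) (u v : ℂ[X]) : V → ℂ[X] :=
  Function.update (Function.update (fun _ => Polynomial.X) a u) b v

omit [Fintype V] in
theorem weightMatrix_pairWeight {a b : V} (hab : a ≠ b) (u v : ℂ[X]) :
    weightMatrix (pairWeight a b u v) θ =
      ((cycleMatrix θ).updateRow a (Pi.single a 1 - u • Pi.single (θ a) 1)).updateRow b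
        (Pi.single b 1 - v • Pi.single (θ b) 1) := by
  ext1 i j
  rcases eq_or_ne i b with rfl | hb
  · simp [weightMatrix, pairWeight, Pi.single_apply, eq_comm]
  · rcases eq_or_ne i a with rfl | ha
    · simp [weightMatrix, pairWeight, Pi.single_apply, hb, Matrix.updateRow_ne, eq_comm]
    · simp [weightMatrix, pairWeight, ha, hb, Matrix.updateRow_ne]

omit [Fintype V] in
theorem weightMatrix_pairWeight_swap {a b : V} (hab : a ≠ b) (u v : ℂ[X]) :
    weightMatrix (pairWeight a b u v) (θ * Equiv.swap a b) =
      ((cycleMatrix θ).updateRow a (Pi.single a 1 - u • Pi.single (θ b) 1)).updateRow b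
        (Pi.single b 1 - v • Pi.single (θ a) 1) := by
  ext1 i j
  rcases eq_or_ne i b with rfl | hb
  · simp [weightMatrix, pairWeight, Pi.single_apply, eq_comm]
  · rcases eq_or_ne i a with rfl | ha
    · simp [weightMatrix, pairWeight, Pi.single_apply, hb, Matrix.updateRow_ne, eq_comm]
    · simp [weightMatrix, pairWeight, ha, hb, Matrix.updateRow_ne, Equiv.swap_apply_of_ne_of_ne]

theorem X_sq_mul_weightDet_swap {a b : V} (hab : a ≠ b) (u v : ℂ[X]) :
    Polynomial.X ^ 2 * weightDet (pairWeight a b u v) (θ * Equiv.swap a b) =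
      (Polynomial.X ^ 2 - u * v) *
          twoRowDet (cycleMatrix θ) a b (Pi.single a 1) (Pi.single b 1) -
        Polynomial.X * v * (cycleMatrix θ).adjugate a b -
        Polynomial.X * u * (cycleMatrix θ).adjugate b a +
        u * v * ((cycleMatrix θ).adjugate a a + (cycleMatrix θ).adjugate b b) -
        u * v * cyclePoly θ := by
  set A := cycleMatrix θ with hA
  have ha : (Polynomial.X : ℂ[X]) • (Pi.single a 1 - u • Pi.single (θ b) 1 : V → ℂ[X]) =
      (Polynomial.X : ℂ[X]) • Pi.single a 1 + (-u) • Pi.single b 1 + u • A b := by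
    rw [hA, cycleMatrix_row]
    module
  have hb : (Polynomial.X : ℂ[X]) • (Pi.single b 1 - v • Pi.single (θ a) 1 : V → ℂ[X]) =
      (Polynomial.X : ℂ[X]) • Pi.single b 1 + (-v) • Pi.single a 1 + v • A a := by
    rw [hA, cycleMatrix_row]
    module
  have h : Polynomial.X ^ 2 * weightDet (pairWeight a b u v) (θ * Equiv.swap a b) =
      twoRowDet A a b ((Polynomial.X : ℂ[X]) • (Pi.single a 1 - u • Pi.single (θ b) 1))
        ((Polynomial.X : ℂ[X]) • (Pi.single b 1 - v • Pi.single (θ a) 1)) := by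
    rw [twoRowDet_smul_left hab, twoRowDet_smul_right, weightDet,
      weightMatrix_pairWeight_swap θ hab, twoRowDet]
    ring
  have h1 : twoRowDet A a b (A b) (Pi.single a 1) = -(A.adjugate a a) := by
    rw [twoRowDet_swap hab, twoRowDet_row_right hab, Matrix.adjugate_apply]
  have h2 : twoRowDet A a b (A b) (Pi.single b 1) = -(A.adjugate b a) := by
    rw [twoRowDet_swap hab, twoRowDet_row_right hab, Matrix.adjugate_apply]
  have h3 : twoRowDet A a b (Pi.single a 1) (A a) = -(A.adjugate a b) := by
    rw [twoRowDet_swap hab, twoRowDet_row_left, Matrix.adjugate_apply]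
  have h4 : twoRowDet A a b (Pi.single b 1) (A a) = -(A.adjugate b b) := by
    rw [twoRowDet_swap hab, twoRowDet_row_left, Matrix.adjugate_apply]
  have h5 : twoRowDet A a b (A b) (A a) = -cyclePoly θ := by
    rw [twoRowDet_swap hab, twoRowDet_row_left, Matrix.updateRow_eq_self]
    rfl
  have h6 : twoRowDet A a b (Pi.single b 1) (Pi.single a 1) =
      -twoRowDet A a b (Pi.single a 1) (Pi.single b 1) := twoRowDet_swap hab _ _
  rw [h, ha, hb]
  simp only [twoRowDet_add_left hab, twoRowDet_smul_left hab, twoRowDet_add_right,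
    twoRowDet_smul_right, twoRowDet_self hab, h1, h2, h3, h4, h5, h6]
  ring

theorem sum_weightDet_swap {K : ℂ[X]} (hK : (1 - Polynomial.X) * K = cyclePoly θ)
    (hK' : ∑ a, ∑ b, (cycleMatrix θ).adjugate a b = (Fintype.card V : ℂ[X]) * K) (u v : ℂ[X]) :
    ∑ a, ∑ b ∈ Finset.univ.erase a, weightDet (pairWeight a b u v) (θ * Equiv.swap a b) =
      (Polynomial.X ^ 2 - u * v) * derivative (derivative (cyclePoly θ)) +
        (Fintype.card V : ℂ[X]) * (Fintype.card V - 1 : ℂ[X]) * cyclePoly θ -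
        2 * (Fintype.card V - 1 : ℂ[X]) * (Polynomial.X * derivative (cyclePoly θ)) -
        (u + v) * ((Fintype.card V : ℂ[X]) * K + derivative (cyclePoly θ)) := by
  have hcard (a : V) : ((Finset.univ.erase a).card : ℂ[X]) = Fintype.card V - 1 := by
    rw [Finset.card_erase_of_mem (Finset.mem_univ a), Finset.card_univ,
      Nat.cast_pred (Fintype.card_pos_iff.2 ⟨a⟩)]
  have hsplit (f : V → V → ℂ[X]) : ∑ a, ∑ b ∈ Finset.univ.erase a, f a b =
      ∑ a, ∑ b, f a b - ∑ a, f a a := by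
    rw [← Finset.sum_sub_distrib]
    exact Finset.sum_congr rfl fun a _ => Finset.sum_erase_eq_sub (Finset.mem_univ a)
  have h1 : ∑ a, ∑ b ∈ Finset.univ.erase a, (cycleMatrix θ).adjugate a b =
      (Fintype.card V : ℂ[X]) * K - ∑ a, (cycleMatrix θ).adjugate a a := by
    rw [hsplit fun a b => (cycleMatrix θ).adjugate a b, hK']
  have h2 : ∑ a, ∑ b ∈ Finset.univ.erase a, (cycleMatrix θ).adjugate b a =
      (Fintype.card V : ℂ[X]) * K - ∑ a, (cycleMatrix θ).adjugate a a := by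
    rw [hsplit fun a b => (cycleMatrix θ).adjugate b a, ← hK']
    congr 1
    exact Finset.sum_comm
  have h3 : ∑ a, ∑ b ∈ Finset.univ.erase a,
      ((cycleMatrix θ).adjugate a a + (cycleMatrix θ).adjugate b b) =
      2 * (Fintype.card V - 1 : ℂ[X]) * ∑ a, (cycleMatrix θ).adjugate a a := by
    rw [hsplit fun a b => (cycleMatrix θ).adjugate a a + (cycleMatrix θ).adjugate b b]
    simp only [Finset.sum_add_distrib, Finset.sum_const, Finset.card_univ, nsmul_eq_mul,
      ← Finset.mul_sum]
    ring
  have h4 : ∑ a : V, ∑ b ∈ Finset.univ.erase a, cyclePoly θ =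
      (Fintype.card V : ℂ[X]) * (Fintype.card V - 1 : ℂ[X]) * cyclePoly θ := by
    simp only [Finset.sum_const, hcard, nsmul_eq_mul, Finset.card_univ, mul_assoc]
  refine mul_left_cancel₀ (pow_ne_zero 2 (Polynomial.X_ne_zero (R := ℂ))) ?_
  rw [Finset.mul_sum, Finset.sum_congr rfl fun a _ => (Finset.mul_sum _ _ _).trans
    (Finset.sum_congr rfl fun b hb => X_sq_mul_weightDet_swap θ (Finset.ne_of_mem_erase hb).symm u v)]
  simp only [Finset.sum_add_distrib, Finset.sum_sub_distrib, ← Finset.mul_sum] at h3 ⊢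
  rw [h1, h2, h3, h4, sum_twoRowDet_single, trace_adjugate_cycleMatrix]
  linear_combination -Polynomial.X * (u + v) * (Fintype.card V : ℂ[X]) * hK

theorem X_mul_sum_weightDet_support :
    Polynomial.X * ∑ a ∈ θ.support, weightDet (pairWeight a (θ a) 1 1) θ =
      (Fintype.card V : ℂ[X]) * Polynomial.X * cyclePoly θ +
        (1 - Polynomial.X ^ 2) * derivative (cyclePoly θ) +
        (Fintype.card V - θ.support.card : ℂ[X]) * cyclePoly θ := by
  set A := cycleMatrix θ with hA
  have hterm {a : V} (ha : a ∈ θ.support) :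
      Polynomial.X ^ 2 * weightDet (pairWeight a (θ a) 1 1) θ =
        (Polynomial.X - 1) * Polynomial.X * A.adjugate (θ a) (θ a) +
          (Polynomial.X - 1) * A.adjugate a a + cyclePoly θ := by
    have hab : a ≠ θ a := (Equiv.Perm.mem_support.1 ha).symm
    have h (c : V) : (Polynomial.X : ℂ[X]) • (Pi.single c 1 - (1 : ℂ[X]) • Pi.single (θ c) 1) =
        (Polynomial.X - 1 : ℂ[X]) • Pi.single c 1 + A c := by
      rw [hA, cycleMatrix_row]
      module
    have hsingle : (Pi.single a 1 : V → ℂ[X]) =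
        A a + (Polynomial.X : ℂ[X]) • Pi.single (θ a) 1 := by
      rw [hA, cycleMatrix_row]
      module
    have h0 : twoRowDet A a (θ a) (Pi.single a 1) (Pi.single (θ a) 1) =
        A.adjugate (θ a) (θ a) := by
      rw [hsingle, twoRowDet_add_left hab, twoRowDet_smul_left hab, twoRowDet_self hab,
        twoRowDet_row_left, Matrix.adjugate_apply]
      ring
    have h1 : twoRowDet A a (θ a) (Pi.single a 1) (A (θ a)) = A.adjugate a a := by
      rw [twoRowDet_row_right hab, Matrix.adjugate_apply]
    have h2 : twoRowDet A a (θ a) (A a) (Pi.single (θ a) 1) = A.adjugate (θ a) (θ a) := by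
      rw [twoRowDet_row_left, Matrix.adjugate_apply]
    have h3 : twoRowDet A a (θ a) (A a) (A (θ a)) = cyclePoly θ := by
      rw [twoRowDet_row_left, Matrix.updateRow_eq_self]
      rfl
    have h4 : Polynomial.X ^ 2 * weightDet (pairWeight a (θ a) 1 1) θ =
        twoRowDet A a (θ a)
          ((Polynomial.X : ℂ[X]) • (Pi.single a 1 - (1 : ℂ[X]) • Pi.single (θ a) 1))
          ((Polynomial.X : ℂ[X]) • (Pi.single (θ a) 1 - (1 : ℂ[X]) • Pi.single (θ (θ a)) 1)) := by
      rw [twoRowDet_smul_left hab, twoRowDet_smul_right, weightDet,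
        weightMatrix_pairWeight θ hab, twoRowDet]
      ring
    rw [h4, h, h]
    simp only [twoRowDet_add_left hab, twoRowDet_smul_left hab, twoRowDet_add_right,
      twoRowDet_smul_right, h0, h1, h2, h3]
    ring
  have hshift : ∑ a ∈ θ.support, A.adjugate (θ a) (θ a) = ∑ a ∈ θ.support, A.adjugate a a :=
    Finset.sum_bijective θ θ.bijective (by simp) (by simp)
  have hfix : ∑ a ∈ θ.supportᶜ, (1 - Polynomial.X) * A.adjugate a a =
      (Fintype.card V - θ.support.card : ℂ[X]) * cyclePoly θ := by
    rw [Finset.sum_congr rfl fun a ha => ?_, Finset.sum_const, Finset.card_compl, nsmul_eq_mul,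
      Nat.cast_sub (Finset.card_le_univ _)]
    have hfa : θ a = a := by simpa using ha
    have : cycleMatrix θ a = (1 - Polynomial.X : ℂ[X]) • Pi.single a 1 := by
      rw [cycleMatrix_row, hfa]
      module
    rw [Matrix.adjugate_apply, ← Matrix.det_updateRow_smul, ← this, hA, Matrix.updateRow_eq_self]
    rfl
  have htot : ∑ a ∈ θ.support, A.adjugate a a + ∑ a ∈ θ.supportᶜ, A.adjugate a a =
      ∑ a, A.adjugate a a := Finset.sum_add_sum_compl _ _
  rw [trace_adjugate_cycleMatrix] at htot
  refine mul_left_cancel₀ (Polynomial.X_ne_zero (R := ℂ)) ?_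
  rw [← mul_assoc, ← pow_two, Finset.mul_sum, Finset.sum_congr rfl fun a ha => hterm ha]
  simp only [Finset.sum_add_distrib, ← Finset.mul_sum, hshift, Finset.sum_const,
    nsmul_eq_mul] at hfix ⊢
  linear_combination (Polynomial.X ^ 2 - 1) * htot + (Polynomial.X + 1) * hfix

end PairSums

section PochSum

/-- The linear functional sending `X ^ k` to the falling factorial of `s - k` of length `d`. -/
noncomputable def pochSum (d : ℕ) (s : ℂ) : ℂ[X] →ₗ[ℂ] ℂ :=
  Polynomial.lsum fun k => (descPochhammer ℂ d).eval (s - k) • LinearMap.id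

theorem pochSum_monomial (d : ℕ) (s : ℂ) (k : ℕ) (c : ℂ) :
    pochSum d s (Polynomial.monomial k c) = (descPochhammer ℂ d).eval (s - k) * c := by
  simp [pochSum, Polynomial.lsum_apply, Polynomial.sum_monomial_index]

theorem pochSum_C_mul (d : ℕ) (s c : ℂ) (G : ℂ[X]) :
    pochSum d s (Polynomial.C c * G) = c * pochSum d s G := by
  rw [← Polynomial.smul_eq_C_mul, map_smul, smul_eq_mul]

theorem pochSum_X_mul (d : ℕ) (s : ℂ) (G : ℂ[X]) :
    pochSum d s (Polynomial.X * G) = pochSum d (s - 1) G := by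
  induction G using Polynomial.induction_on' with
  | add p q hp hq => rw [mul_add, map_add, map_add, hp, hq]
  | monomial k c =>
    rw [Polynomial.X_mul_monomial, pochSum_monomial, pochSum_monomial]
    push_cast
    ring_nf

theorem pochSum_derivative_monomial (d : ℕ) (s : ℂ) (k : ℕ) (c : ℂ) :
    pochSum d s (derivative (Polynomial.monomial k c)) =
      (descPochhammer ℂ d).eval (s + 1 - k) * (c * k) := by
  rw [Polynomial.derivative_monomial, pochSum_monomial]
  cases k with
  | zero => simp
  | succ k =>
    push_cast
    simp

theorem pochSum_derivative_derivative_monomial (d : ℕ) (s : ℂ) (k : ℕ) (c : ℂ) :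
    pochSum d s (derivative (derivative (Polynomial.monomial k c))) =
      (descPochhammer ℂ d).eval (s + 2 - k) * (c * k * (k - 1)) := by
  rw [Polynomial.derivative_monomial, pochSum_derivative_monomial]
  cases k with
  | zero => simp
  | succ k =>
    rw [Nat.add_sub_cancel]
    push_cast
    ring_nf

theorem eval_descPochhammer_succ_left (d : ℕ) (y : ℂ) :
    (descPochhammer ℂ (d + 1)).eval (y + 1) = (y + 1) * (descPochhammer ℂ d).eval y := by
  rw [descPochhammer_succ_left]
  simp

theorem pochSum_one_sub_X_mul (d : ℕ) (s : ℂ) (G : ℂ[X]) :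
    pochSum (d + 1) (s + 1) ((1 - Polynomial.X) * G) = (d + 1) * pochSum d s G := by
  rw [sub_mul, one_mul, map_sub, pochSum_X_mul, add_sub_cancel_right]
  induction G using Polynomial.induction_on' with
  | add p q hp hq =>
    simp only [map_add, mul_add]
    linear_combination hp + hq
  | monomial k c =>
    rw [pochSum_monomial, pochSum_monomial, pochSum_monomial, add_sub_right_comm,
      eval_descPochhammer_succ_left, descPochhammer_succ_eval]
    ring

theorem pochSum_fullCycle_step (d : ℕ) (z : ℂ) (H : ℂ[X]) :
    (d + 2) * (pochSum (d + 1) (z + d) (Polynomial.X * (Polynomial.X * derivative (derivative H))) -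
        pochSum (d + 1) (z + d) (Polynomial.X * derivative (derivative H)) +
        (d + 1) * d * pochSum (d + 1) (z + d) H -
        2 * d * pochSum (d + 1) (z + d) (Polynomial.X * derivative H) -
        pochSum (d + 1) (z + d) (derivative H) -
        pochSum (d + 1) (z + d) (Polynomial.X * derivative H) +
        z * ((d + 1) * pochSum (d + 1) (z + d) H + pochSum (d + 1) (z + d) (derivative H) -
          pochSum (d + 1) (z + d) (Polynomial.X * derivative H))) -
      (d + 1) * (pochSum (d + 2) (z + d + 1) H + pochSum (d + 2) (z + d) H) =
      (d + 1) * d * pochSum (d + 2) (z + d + 1) H := by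
  induction H using Polynomial.induction_on' with
  | add p q hp hq =>
    simp only [map_add, mul_add] at hp hq ⊢
    linear_combination hp + hq
  | monomial k c =>
    simp only [pochSum_X_mul, pochSum_monomial, pochSum_derivative_monomial,
      pochSum_derivative_derivative_monomial]
    set Y : ℂ := z + d - k with hY
    have e1 : z + d - 1 - 1 + 2 - k = Y := by rw [hY]; ring
    have e2 : z + d - 1 + 2 - k = Y + 1 := by rw [hY]; ring
    have e3 : z + d - 1 + 1 - k = Y := by rw [hY]; ring
    have e4 : z + d + 1 - k = Y + 1 := by rw [hY]; ring
    rw [e1, e2, e3, e4]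
    simp only [eval_descPochhammer_succ_left]
    simp only [descPochhammer_succ_eval, hY]
    push_cast
    ring

theorem pochSum_classSum (d : ℕ) (z : ℂ) (H : ℂ[X]) :
    pochSum (d + 2) (z + d + 1) (Polynomial.X * (Polynomial.X * derivative (derivative H))) -
        pochSum (d + 2) (z + d + 1) (derivative (derivative H)) +
        (d + 3) * (d + 2) * pochSum (d + 2) (z + d + 1) H -
        2 * (d + 2) * pochSum (d + 2) (z + d + 1) (Polynomial.X * derivative H) -
        2 * pochSum (d + 2) (z + d + 1) (derivative H) -
        2 * pochSum (d + 3) (z + d + 2) H +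
        2 * z * ((d + 3) * pochSum (d + 2) (z + d + 2) (Polynomial.X * H) +
          pochSum (d + 2) (z + d + 2) (derivative H) -
          pochSum (d + 2) (z + d + 2) (Polynomial.X * (Polynomial.X * derivative H))) =
      (d + 2) * z * ((z + 1) * pochSum (d + 1) (z + d + 2) H +
        (z - 1) * pochSum (d + 1) (z + d + 1) H) := by
  induction H using Polynomial.induction_on' with
  | add p q hp hq =>
    simp only [map_add, mul_add] at hp hq ⊢
    linear_combination hp + hq
  | monomial k c =>
    simp only [pochSum_X_mul, pochSum_monomial, pochSum_derivative_monomial,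
      pochSum_derivative_derivative_monomial]
    set Y : ℂ := z + d + 1 - k with hY
    have e1 : z + d + 1 - 1 - 1 + 2 - k = Y := by rw [hY]; ring
    have e2 : z + d + 1 + 2 - k = Y + 1 + 1 := by rw [hY]; ring
    have e3 : z + d + 1 - 1 + 1 - k = Y := by rw [hY]; ring
    have e4 : z + d + 1 + 1 - k = Y + 1 := by rw [hY]; ring
    have e5 : z + d + 2 - k = Y + 1 := by rw [hY]; ring
    have e6 : z + d + 2 - 1 - k = Y := by rw [hY]; ring
    have e7 : z + d + 2 + 1 - k = Y + 1 + 1 := by rw [hY]; ring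
    have e8 : z + d + 2 - 1 - 1 + 1 - k = Y := by rw [hY]; ring
    rw [e1, e2, e3, e4, e5, e6, e7, e8]
    simp only [eval_descPochhammer_succ_left]
    simp only [descPochhammer_succ_eval, hY]
    push_cast
    ring

end PochSum

section FullCycles

variable {V : Type*} [Fintype V] [DecidableEq V]

/-- The sum of `z ^ κ(τ γ)` over the permutations `γ` with exactly one cycle. -/
noncomputable def fullCycleSum (z : ℂ) (τ : Equiv.Perm V) : ℂ :=
  ∑ γ : Equiv.Perm V with cycleCount γ = 1, z ^ cycleCount (τ * γ)

theorem fullCycleSum_permCongr {W : Type*} [Fintype W] [DecidableEq W] (e : V ≃ W) (z : ℂ)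
    (τ : Equiv.Perm V) : fullCycleSum z (e.permCongr τ) = fullCycleSum z τ := by
  unfold fullCycleSum
  symm
  refine Finset.sum_equiv e.permCongr (fun γ => by simp [cycleCount_permCongr]) fun γ _ => ?_
  rw [← Equiv.permCongr_mul, cycleCount_permCongr]

theorem cyclePoly_permCongr {W : Type*} [Fintype W] [DecidableEq W] (e : V ≃ W)
    (τ : Equiv.Perm V) : cyclePoly (e.permCongr τ) = cyclePoly τ :=
  weightDet_permCongr e (fun _ => Polynomial.X) τ

theorem cycleCount_mul_optionCongr (θ : Equiv.Perm (Option V)) (γ : Equiv.Perm V) :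
    cycleCount (θ * Equiv.optionCongr γ) =
      cycleCount (Equiv.removeNone θ * γ) + if θ none = none then 1 else 0 := by
  rw [cycleCount_removeNone, removeNone_mul_optionCongr]
  simp

omit [Fintype V] in
theorem permCongr_swap {W : Type*} [DecidableEq W] (e : V ≃ W) (a b : V) :
    e.permCongr (Equiv.swap a b) = Equiv.swap (e a) (e b) :=
  Equiv.symm_trans_swap_trans a b e

theorem fullCycleSum_option [Nonempty V] (z : ℂ) (τ : Equiv.Perm (Option V)) :
    fullCycleSum z τ = ∑ i : V, (if τ (some i) = none then z else 1) *
      fullCycleSum z (Equiv.removeNone (τ * Equiv.swap none (some i))) := by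
  have h1 (i : V) (γ : Equiv.Perm V) :
      cycleCount (Equiv.swap none (some i) * Equiv.optionCongr γ) = cycleCount γ := by
    have h : Equiv.removeNone (Equiv.swap none (some i)) = (1 : Equiv.Perm V) := by
      apply Equiv.optionCongr_injective
      rw [map_equiv_removeNone]
      simp
    rw [cycleCount_mul_optionCongr, h]
    simp
  have h2 (γ : Equiv.Perm V) : cycleCount (Equiv.swap none none * Equiv.optionCongr γ) ≠ 1 := by
    have := cycleCount_pos γ
    rw [Equiv.swap_self, ← Equiv.Perm.one_def, one_mul, cycleCount_optionCongr]
    omega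
  unfold fullCycleSum
  rw [Finset.sum_filter, ← Equiv.Perm.decomposeOption.symm.sum_comp, Fintype.sum_prod_type,
    Fintype.sum_option]
  simp only [Equiv.Perm.decomposeOption_symm_apply, h2, if_false, Finset.sum_const_zero, zero_add,
    h1]
  simp only [← mul_assoc, cycleCount_mul_optionCongr, pow_add, Finset.sum_filter, Finset.mul_sum]
  refine Finset.sum_congr rfl fun i _ => Finset.sum_congr rfl fun γ _ => ?_
  simp only [Equiv.Perm.mul_apply, Equiv.swap_apply_left]
  split_ifs <;> ring

theorem cyclePoly_removeNone {θ : Equiv.Perm (Option V)} (h : θ none ≠ none) :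
    cyclePoly (Equiv.removeNone θ) =
      weightDet (Function.update (fun _ => Polynomial.X) none 1) θ := by
  rw [weightDet_removeNone h (by simp), cyclePoly]
  congr 1

omit [Fintype V] [DecidableEq V] in
theorem removeNone_mul_swap [DecidableEq V] {τ : Equiv.Perm (Option V)} {i : V} (h : τ (some i) = none) :
    Equiv.removeNone (τ * Equiv.swap none (some i)) = Equiv.removeNone τ := by
  apply Equiv.optionCongr_injective
  rw [map_equiv_removeNone, map_equiv_removeNone]
  have : Equiv.swap none (τ none) = τ * Equiv.swap (some i) none * τ⁻¹ := by
    rw [← h, Equiv.mul_swap_eq_swap_mul, mul_inv_cancel_right]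
  simp [h, this, Equiv.swap_comm]
  rfl

theorem sum_cyclePoly_removeNone (z : ℂ) (τ : Equiv.Perm (Option V)) :
    ∑ i : V, (Polynomial.C (if τ (some i) = none then z else 1)) *
        cyclePoly (Equiv.removeNone (τ * Equiv.swap none (some i))) =
      ∑ b ∈ Finset.univ.erase none,
        weightDet (Function.update (fun _ => Polynomial.X) none 1) (τ * Equiv.swap none b) +
      Polynomial.C z * weightDet (Function.update (fun _ => Polynomial.X) none 1) τ := by
  have hterm (i : V) : (Polynomial.C (if τ (some i) = none then z else 1)) *
      cyclePoly (Equiv.removeNone (τ * Equiv.swap none (some i))) =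
      weightDet (Function.update (fun _ => Polynomial.X) none 1) (τ * Equiv.swap none (some i)) +
        if τ (some i) = none then Polynomial.C z * cyclePoly (Equiv.removeNone τ) else 0 := by
    split_ifs with h
    · rw [weightDet_eq_zero (a := none) (by simp [h]) (by simp), removeNone_mul_swap h, zero_add]
    · rw [cyclePoly_removeNone (by simpa using h), add_zero, Polynomial.C_1, one_mul]
  rw [Finset.sum_congr rfl fun i _ => hterm i, Finset.sum_add_distrib]
  congr 1
  · rw [Finset.sum_erase_eq_sub (Finset.mem_univ _), Fintype.sum_option]
    simp
  · by_cases h : τ none = none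
    · rw [weightDet_eq_zero h (by simp), mul_zero]
      refine Finset.sum_eq_zero fun i _ => if_neg fun hi => ?_
      exact Option.some_ne_none i (τ.injective (hi.trans h.symm))
    · obtain ⟨j, hj⟩ : ∃ j, τ (some j) = none := by
        obtain ⟨x, hx⟩ := τ.surjective none
        cases x with
        | none => exact absurd hx h
        | some j => exact ⟨j, hx⟩
      rw [Finset.sum_eq_single j, if_pos hj, cyclePoly_removeNone h]
      · exact fun i _ hi => if_neg fun hi' =>
          hi (Option.some_injective _ (τ.injective (hi'.trans hj.symm)))
      · simp

omit [Fintype V] in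
theorem update_comp_swap (a b : V) :
    (Function.update (fun _ => Polynomial.X) b (1 : ℂ[X])) ∘ (Equiv.swap a b).symm =
      Function.update (fun _ => Polynomial.X) a 1 := by
  ext1 x
  by_cases h : x = a
  · simp [h]
  · have : Equiv.swap a b x ≠ b := fun h' => h (by
      have := congrArg (Equiv.swap a b) h'
      simpa using this)
    simp [h, this]

omit [Fintype V] in
theorem pairWeight_X {a b : V} (hab : a ≠ b) (u : ℂ[X]) :
    pairWeight a b u Polynomial.X = Function.update (fun _ => Polynomial.X) a u := by
  rw [pairWeight, Function.update_eq_self_iff]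
  simp [hab.symm]

theorem card_mul_fullCycleSum : ∀ (n : ℕ) {V : Type} [Fintype V] [DecidableEq V],
    Fintype.card V = n + 1 → ∀ (z : ℂ) (τ : Equiv.Perm V),
    (n + 1) * (n + 2) * fullCycleSum z τ = pochSum (n + 2) (z + n + 1) (cyclePoly τ) := by
  intro n
  induction n with
  | zero =>
    intro V _ _ hV z τ
    have : Unique V := (Fintype.card_eq_one_iff_nonempty_unique.1 hV).some
    have h1 : cycleCount (1 : Equiv.Perm V) = 1 := by simp [cycleCount]
    have h2 : cyclePoly τ = (1 - Polynomial.X) * 1 := by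
      rw [cyclePoly, weightDet, Matrix.det_unique, mul_one]
      simp [weightMatrix, Subsingleton.elim _ (default : V)]
    have h3 := pochSum_one_sub_X_mul 1 z 1
    rw [← Polynomial.monomial_zero_one, pochSum_monomial, Polynomial.monomial_zero_one] at h3
    simp at h3
    rw [fullCycleSum, Finset.sum_filter, Fintype.sum_unique, h2, Subsingleton.elim τ 1]
    simp [Subsingleton.elim (default : Equiv.Perm V) 1, h1]
    linear_combination -h3
  | succ n ih =>
    intro V _ _ hV z τ
    obtain ⟨e⟩ : Nonempty (V ≃ Option (Fin (n + 1))) := by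
      refine ⟨Fintype.equivOfCardEq ?_⟩
      simp [hV]
    rw [← fullCycleSum_permCongr e, ← cyclePoly_permCongr e]
    generalize e.permCongr τ = σ
    set s : ℂ := z + n + 1 with hs
    have hnone (σ : Equiv.Perm (Option (Fin (n + 1)))) :
        (n + 1) * (n + 2) * fullCycleSum z σ = pochSum (n + 2) s
          (∑ b ∈ Finset.univ.erase none,
            weightDet (Function.update (fun _ => Polynomial.X) none 1) (σ * Equiv.swap none b) +
          Polynomial.C z * weightDet (Function.update (fun _ => Polynomial.X) none 1) σ) := by
      rw [← sum_cyclePoly_removeNone, map_sum, fullCycleSum_option, Finset.mul_sum]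
      refine Finset.sum_congr rfl fun i _ => ?_
      rw [pochSum_C_mul, ← ih (by simp)]
      ring
    have hall (a : Option (Fin (n + 1))) :
        (n + 1) * (n + 2) * fullCycleSum z σ = pochSum (n + 2) s
          (∑ b ∈ Finset.univ.erase a, weightDet (pairWeight a b 1 Polynomial.X) (σ * Equiv.swap a b) +
          Polynomial.C z * weightDet (Function.update (fun _ => Polynomial.X) a 1) σ) := by
      rw [← fullCycleSum_permCongr (Equiv.swap none a), hnone]
      have h1 (ρ : Equiv.Perm (Option (Fin (n + 1)))) :
          weightDet (Function.update (fun _ => Polynomial.X) none 1)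
            ((Equiv.swap none a).permCongr ρ) =
          weightDet (Function.update (fun _ => Polynomial.X) a 1) ρ := by
        rw [← weightDet_permCongr (Equiv.swap none a) (Function.update _ a 1) ρ, update_comp_swap]
      rw [h1]
      congr 2
      refine Finset.sum_equiv (Equiv.swap none a) (fun b => ?_) fun b hb => ?_
      · simp [Equiv.swap_apply_eq_iff]
      · have h2 : (Equiv.swap none a).permCongr σ * Equiv.swap none b =
            (Equiv.swap none a).permCongr (σ * Equiv.swap a (Equiv.swap none a b)) := by
          rw [Equiv.permCongr_mul, permCongr_swap]
          simp
        have hne : a ≠ Equiv.swap none a b := fun h => by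
          have := congrArg (Equiv.swap none a) h
          simp at this
          exact Finset.ne_of_mem_erase hb this.symm
        rw [h2, h1, pairWeight_X hne]
    obtain ⟨K, hK, hK'⟩ := exists_cyclePoly_quotient σ
    have hsum := Finset.sum_congr (rfl : (Finset.univ : Finset (Option (Fin (n + 1)))) = _)
      fun a _ => hall a
    have hC2 : (2 : ℂ[X]) = Polynomial.C 2 := (map_ofNat Polynomial.C 2).symm
    have hcard : (Fintype.card (Option (Fin (n + 1))) : ℂ[X]) = Polynomial.C (n + 2 : ℂ) := by
      rw [map_add, ← hC2]
      simp
      ring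
    have hcard' : (Fintype.card (Option (Fin (n + 1))) : ℂ) = n + 2 := by
      simp
      ring
    have hC : (Polynomial.C (n + 2 : ℂ) - 1 : ℂ[X]) = Polynomial.C (n + 1 : ℂ) := by
      rw [map_add, map_add, ← hC2, Polynomial.C_1]
      ring
    rw [Finset.sum_const, Finset.card_univ, nsmul_eq_mul, hcard', ← map_sum,
      Finset.sum_add_distrib, ← Finset.mul_sum, X_mul_sum_weightDet_one,
      sum_weightDet_swap σ hK hK', hcard, hC, hC2] at hsum
    set H := cyclePoly σ
    have hexpand : (Polynomial.X ^ 2 - 1 * Polynomial.X) * derivative (derivative H) +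
          Polynomial.C (n + 2 : ℂ) * Polynomial.C (n + 1 : ℂ) * H -
          Polynomial.C 2 * Polynomial.C (n + 1 : ℂ) * (Polynomial.X * derivative H) -
          (1 + Polynomial.X) * (Polynomial.C (n + 2 : ℂ) * K + derivative H) +
          Polynomial.C z * (Polynomial.C (n + 2 : ℂ) * H + (1 - Polynomial.X) * derivative H) =
        Polynomial.X * (Polynomial.X * derivative (derivative H)) -
          Polynomial.X * derivative (derivative H) +
          Polynomial.C (n + 2 : ℂ) * (Polynomial.C (n + 1 : ℂ) * H) -
          Polynomial.C 2 * (Polynomial.C (n + 1 : ℂ) * (Polynomial.X * derivative H)) -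
          Polynomial.C (n + 2 : ℂ) * K - Polynomial.C (n + 2 : ℂ) * (Polynomial.X * K) -
          derivative H - Polynomial.X * derivative H +
          Polynomial.C z * (Polynomial.C (n + 2 : ℂ) * H + derivative H -
            Polynomial.X * derivative H) := by
      ring
    rw [hexpand] at hsum
    have hq := pochSum_one_sub_X_mul (n + 2) s K
    have hq' := pochSum_one_sub_X_mul (n + 2) (s - 1) K
    have hstep := pochSum_fullCycle_step (n + 1) z H
    rw [hK] at hq hq'
    rw [← pochSum_X_mul, sub_add_cancel] at hq'
    have hs' : z + ((n + 1 : ℕ) : ℂ) = s := by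
      rw [hs]
      push_cast
      ring
    rw [hs'] at hstep ⊢
    simp only [LinearMap.map_add, LinearMap.map_sub, pochSum_C_mul] at hsum
    rw [show n + 1 + 1 = n + 2 from rfl, show n + 1 + 2 = n + 3 from rfl] at hstep
    rw [show n + 2 + 1 = n + 3 from rfl] at hq hq'
    rw [show n + 1 + 2 = n + 3 from rfl]
    push_cast at hq hq' hstep ⊢
    have hn : (n + 1 : ℂ) * (n + 2) ≠ 0 := by
      have h1 : (n + 1 : ℂ) ≠ 0 := by exact_mod_cast n.succ_ne_zero
      have h2 : (n + 2 : ℂ) ≠ 0 := by exact_mod_cast (n + 1).succ_ne_zero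
      exact mul_ne_zero h1 h2
    refine mul_left_cancel₀ hn ?_
    linear_combination (n + 3 : ℂ) * hsum + hstep + (n + 2 : ℂ) * (hq + hq')

end FullCycles

section ClassSum

variable {V : Type*} [Fintype V] [DecidableEq V]

/-- The generating polynomial attached to an ordered pair of points, whose image under `pochSum`
counts cycles in the products of `ω` with the permutations made of the transposition `(a b)` and of
one cycle through all the other points. -/
noncomputable def pairPoly (z : ℂ) (ω : Equiv.Perm V) (a b : V) : ℂ[X] :=
  weightDet (pairWeight a b 1 1) (ω * Equiv.swap a b) +
    Polynomial.C z * ((if ω b = a then weightDet (pairWeight a b 1 1) ω else 0) +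
      if ω a = b then weightDet (pairWeight a b 1 1) ω else 0)

theorem pairWeight_permCongr {W : Type*} [Fintype W] [DecidableEq W] (e : V ≃ W) (a b : V)
    (u v : ℂ[X]) (ω : Equiv.Perm V) :
    weightDet (pairWeight (e a) (e b) u v) (e.permCongr ω) = weightDet (pairWeight a b u v) ω := by
  rw [← weightDet_permCongr e]
  congr 1
  ext1 x
  obtain ⟨y, rfl⟩ := e.surjective x
  simp [pairWeight, Function.update_apply]

theorem pairPoly_permCongr {W : Type*} [Fintype W] [DecidableEq W] (e : V ≃ W) (z : ℂ)
    (ω : Equiv.Perm V) (a b : V) :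
    pairPoly z (e.permCongr ω) (e a) (e b) = pairPoly z ω a b := by
  simp only [pairPoly, ← permCongr_swap, ← Equiv.permCongr_mul, pairWeight_permCongr,
    Equiv.permCongr_apply, Equiv.symm_apply_apply, e.apply_eq_iff_eq]

omit [Fintype V] in
theorem pairWeight_comm {a b : V} (hab : a ≠ b) (u v : ℂ[X]) :
    pairWeight a b u v = pairWeight b a v u :=
  Function.update_comm hab _ _ _

theorem sum_pairPoly (z : ℂ) (ω : Equiv.Perm V) :
    ∑ a, ∑ b ∈ Finset.univ.erase a, pairPoly z ω a b =
      ∑ a, ∑ b ∈ Finset.univ.erase a, weightDet (pairWeight a b 1 1) (ω * Equiv.swap a b) +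
        Polynomial.C (2 * z) * ∑ a ∈ ω.support, weightDet (pairWeight a (ω a) 1 1) ω := by
  have h1 : ∑ a, ∑ b ∈ Finset.univ.erase a,
      (if ω a = b then weightDet (pairWeight a b 1 1) ω else 0) =
      ∑ a ∈ ω.support, weightDet (pairWeight a (ω a) 1 1) ω := by
    rw [← Finset.sum_subset (Finset.subset_univ ω.support)]
    · refine Finset.sum_congr rfl fun a ha => ?_
      rw [Finset.sum_ite_eq, if_pos]
      simpa using ha
    · intro a _ ha
      rw [Finset.sum_ite_eq, if_neg]
      simpa using ha
  have h2 : ∑ a, ∑ b ∈ Finset.univ.erase a,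
      (if ω b = a then weightDet (pairWeight a b 1 1) ω else 0) =
      ∑ a ∈ ω.support, weightDet (pairWeight a (ω a) 1 1) ω := by
    rw [← h1, Finset.sum_comm' (t' := Finset.univ) (s' := fun b => Finset.univ.erase b)
      (by simp [eq_comm])]
    refine Finset.sum_congr rfl fun a _ => Finset.sum_congr rfl fun b hb => ?_
    rw [pairWeight_comm (Finset.ne_of_mem_erase hb)]
  simp only [pairPoly, Finset.sum_add_distrib, ← Finset.mul_sum, h1, h2, map_mul]
  rw [map_ofNat Polynomial.C 2]
  ring

theorem pochSum_sum_pairPoly (d : ℕ) (hV : Fintype.card V = d + 3) (z : ℂ) (ω : Equiv.Perm V) :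
    pochSum (d + 2) (z + d + 1) (∑ a, ∑ b ∈ Finset.univ.erase a, pairPoly z ω a b) =
      (d + 2) * z * ((z + 1) * pochSum (d + 1) (z + d + 2) (cyclePoly ω) +
        (z - 1) * pochSum (d + 1) (z + d + 1) (cyclePoly ω)) +
      2 * z * (Fintype.card V - ω.support.card : ℂ) *
        pochSum (d + 2) (z + d + 2) (cyclePoly ω) := by
  have : Nonempty V := Fintype.card_pos_iff.1 (by omega)
  obtain ⟨K, hK, hK'⟩ := exists_cyclePoly_quotient ω
  have hC2 : (2 : ℂ[X]) = Polynomial.C 2 := (map_ofNat Polynomial.C 2).symm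
  have hcard : (Fintype.card V : ℂ[X]) = Polynomial.C (d + 3 : ℂ) := by
    rw [hV, map_add, map_ofNat Polynomial.C 3]
    simp
  have hC : (Polynomial.C (d + 3 : ℂ) - 1 : ℂ[X]) = Polynomial.C (d + 2 : ℂ) := by
    rw [← Polynomial.C_1, ← map_sub]
    congr 1
    ring
  have hsupp : (Polynomial.C (d + 3 : ℂ) - ω.support.card : ℂ[X]) =
      Polynomial.C (Fintype.card V - ω.support.card : ℂ) := by
    rw [map_sub, hV]
    simp
  have hZ := X_mul_sum_weightDet_support ω
  set Z := ∑ a ∈ ω.support, weightDet (pairWeight a (ω a) 1 1) ω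
  rw [sum_pairPoly, sum_weightDet_swap ω hK hK', hcard, hC, hC2]
  rw [hcard, hsupp] at hZ
  set H := cyclePoly ω
  set f : ℂ := Fintype.card V - ω.support.card
  have hexpand : (Polynomial.X ^ 2 - 1 * 1) * derivative (derivative H) +
        Polynomial.C (d + 3 : ℂ) * Polynomial.C (d + 2 : ℂ) * H -
        Polynomial.C 2 * Polynomial.C (d + 2 : ℂ) * (Polynomial.X * derivative H) -
        (1 + 1) * (Polynomial.C (d + 3 : ℂ) * K + derivative H) =
      Polynomial.X * (Polynomial.X * derivative (derivative H)) - derivative (derivative H) +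
        Polynomial.C (d + 3 : ℂ) * (Polynomial.C (d + 2 : ℂ) * H) -
        Polynomial.C 2 * (Polynomial.C (d + 2 : ℂ) * (Polynomial.X * derivative H)) -
        Polynomial.C 2 * (Polynomial.C (d + 3 : ℂ) * K) - Polynomial.C 2 * derivative H := by
    rw [← hC2]
    ring
  have hexpand' : Polynomial.C (d + 3 : ℂ) * Polynomial.X * H +
        (1 - Polynomial.X ^ 2) * derivative H + Polynomial.C f * H =
      Polynomial.C (d + 3 : ℂ) * (Polynomial.X * H) + derivative H -
        Polynomial.X * (Polynomial.X * derivative H) + Polynomial.C f * H := by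
    ring
  rw [hexpand'] at hZ
  have hZ' := congrArg (pochSum (d + 2) (z + d + 2)) hZ
  rw [pochSum_X_mul, show z + d + 2 - 1 = z + d + 1 by ring] at hZ'
  rw [hexpand]
  simp only [LinearMap.map_add, LinearMap.map_sub, pochSum_C_mul] at hZ' ⊢
  have hq := pochSum_one_sub_X_mul (d + 2) (z + d + 1) K
  rw [hK, show z + d + 1 + 1 = z + d + 2 by ring, show d + 2 + 1 = d + 3 from rfl] at hq
  push_cast at hq
  linear_combination pochSum_classSum d z H + 2 * z * hZ' + 2 * hq

omit [Fintype V] in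
theorem optionCongr_removeNone (σ : Equiv.Perm (Option V)) :
    Equiv.optionCongr (Equiv.removeNone σ) = Equiv.swap none (σ none) * σ :=
  map_equiv_removeNone σ

omit [Fintype V] in
theorem removeNone_removeNone_mul_swap {ω : Equiv.Perm (Option (Option V))}
    (ha : ω none = some none) (hb : ω (some none) ≠ none) :
    Equiv.removeNone (Equiv.removeNone (ω * Equiv.swap none (some none))) =
      Equiv.removeNone (Equiv.removeNone ω) := by
  obtain ⟨k, hk⟩ := Option.ne_none_iff_exists'.1 hb
  have hk' : Equiv.removeNone ω none = k :=
    Option.some_injective _ ((Equiv.removeNone_some ω ⟨k, hk⟩).trans hk)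
  have h : Equiv.removeNone (ω * Equiv.swap none (some none)) =
      Equiv.optionCongr (Equiv.removeNone (Equiv.removeNone ω)) := by
    rw [optionCongr_removeNone, hk']
    apply Equiv.optionCongr_injective
    have h1 : Equiv.optionCongr (Equiv.swap none k * Equiv.removeNone ω) =
        Equiv.optionCongr (Equiv.swap none k) * Equiv.optionCongr (Equiv.removeNone ω) := by
      ext1 x
      cases x <;> simp only [Equiv.Perm.mul_apply, Equiv.optionCongr_apply, Option.map_none,
        Option.map_some]
    rw [h1, Equiv.optionCongr_swap, optionCongr_removeNone, optionCongr_removeNone,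
      Equiv.mul_swap_eq_swap_mul, Equiv.Perm.mul_apply, Equiv.swap_apply_left, ha, hk,
      ← mul_assoc, ← mul_assoc]
    congr 1
    rw [Equiv.mul_swap_eq_swap_mul (Equiv.swap (some none) _), Equiv.swap_apply_left,
      Equiv.swap_apply_of_ne_of_ne (by simp) (by simp)]
  rw [h, Equiv.removeNone_optionCongr]

theorem pairPoly_none {z : ℂ} {ω θ : Equiv.Perm (Option (Option V))}
    (hθ : θ = ω * Equiv.swap none (some none))
    (h2 : ∀ a b, a ≠ b → ω a = b → ω b ≠ a) (h1 : ∀ a b, ω a = a → ω b = b → a = b) :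
    pairPoly z ω none (some none) =
      Polynomial.C ((if θ none = none then z else 1) *
        if Equiv.removeNone θ none = none then z else 1) *
      cyclePoly (Equiv.removeNone (Equiv.removeNone θ)) := by
  have hθ0 : θ none = ω (some none) := by simp [hθ]
  have hθ1 : θ (some none) = ω none := by simp [hθ]
  have hred {ρ : Equiv.Perm (Option (Option V))} (hρ : ρ none ≠ none)
      (hρ' : Equiv.removeNone ρ none ≠ none) :
      weightDet (pairWeight none (some none) 1 1) ρ =
        cyclePoly (Equiv.removeNone (Equiv.removeNone ρ)) := by
    rw [weightDet_removeNone hρ (by simp [pairWeight]), cyclePoly_removeNone hρ']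
    congr 1
    ext1 x
    cases x <;> simp [pairWeight]
  have hrem {ρ : Equiv.Perm (Option (Option V))} (hρ : ρ (some none) ≠ none) :
      some (Equiv.removeNone ρ none) = ρ (some none) := by
    obtain ⟨k, hk⟩ := Option.ne_none_iff_exists'.1 hρ
    exact Equiv.removeNone_some ρ ⟨k, hk⟩
  unfold pairPoly
  rw [← hθ, hθ0]
  by_cases hb : ω (some none) = none
  · have ha : ω none ≠ some none := h2 _ _ (by simp) hb
    have ha' : ω none ≠ none := fun h => by simpa using ω.injective (h.trans hb.symm)
    have hrr : Equiv.removeNone θ = Equiv.removeNone ω := by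
      rw [hθ, removeNone_mul_swap hb]
    have hrn : Equiv.removeNone θ none ≠ none := fun h => by
      have := hrem (ρ := θ) (by rwa [hθ1])
      rw [h, hθ1] at this
      exact ha this.symm
    rw [weightDet_eq_zero (a := none) (hθ0.trans hb) (by simp [pairWeight]), if_pos hb, if_neg ha,
      if_pos hb, if_neg hrn, hrr, hred ha' (hrr ▸ hrn)]
    simp
  · rw [if_neg hb, if_neg hb]
    by_cases ha : ω none = some none
    · have hbb : ω (some none) ≠ some none := fun h => by simpa using ω.injective (h.trans ha.symm)
      have hrn : Equiv.removeNone θ none = none := by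
        have := hrem (ρ := θ) (by simp [hθ1, ha])
        rw [hθ1, ha] at this
        exact Option.some_injective _ this
      have hrn' : Equiv.removeNone ω none ≠ none := fun h => by
        have := hrem hb
        rw [h] at this
        exact hbb this.symm
      rw [weightDet_removeNone (by rwa [hθ0]) (by simp [pairWeight]),
        weightDet_eq_zero hrn (by simp [pairWeight]), if_pos ha, if_pos hrn, hθ,
        removeNone_removeNone_mul_swap ha hb, hred (by simp [ha]) hrn']
      simp
    · have hrn : Equiv.removeNone θ none ≠ none := fun h => by
        by_cases h3 : ω none = none
        · have h4 := Equiv.removeNone_none θ (hθ1.trans h3)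
          rw [h, hθ0] at h4
          simpa using h1 _ _ h3 h4.symm
        · have := hrem (ρ := θ) (by rwa [hθ1])
          rw [h, hθ1] at this
          exact ha this.symm
      rw [if_neg ha, if_neg hrn, hred (by rwa [hθ0]) hrn]
      simp

end ClassSum

section Averaging

variable {V : Type*} [Fintype V] [DecidableEq V]

theorem card_mul_sum_fullCycle (d : ℕ) {ω : Equiv.Perm (Option (Option (Fin (d + 1))))} (z : ℂ)
    (h2 : ∀ a b, a ≠ b → ω a = b → ω b ≠ a) (h1 : ∀ a b, ω a = a → ω b = b → a = b) :
    (d + 1) * (d + 2) * ∑ γ : Equiv.Perm (Fin (d + 1)) with cycleCount γ = 1,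
      z ^ cycleCount (ω * (Equiv.swap none (some none) *
        Equiv.optionCongr (Equiv.optionCongr γ))) =
      pochSum (d + 2) (z + d + 1) (pairPoly z ω none (some none)) := by
  rw [pairPoly_none rfl h2 h1, pochSum_C_mul, ← card_mul_fullCycleSum d (by simp), fullCycleSum]
  simp only [Finset.mul_sum, ← mul_assoc]
  refine Finset.sum_congr rfl fun γ _ => ?_
  rw [cycleCount_mul_optionCongr, cycleCount_mul_optionCongr]
  split_ifs <;> ring

omit [Fintype V] in
theorem exists_perm_apply_pair {a b a' b' : V} (h : a ≠ b) (h' : a' ≠ b') :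
    ∃ g : Equiv.Perm V, g a = a' ∧ g b = b' := by
  refine ⟨Equiv.swap (Equiv.swap a a' b) b' * Equiv.swap a a', ?_, by simp⟩
  rw [Equiv.Perm.mul_apply, Equiv.swap_apply_left, Equiv.swap_apply_of_ne_of_ne _ h']
  intro hab
  have := congrArg (Equiv.swap a a') hab
  rw [Equiv.swap_apply_right, Equiv.swap_apply_self] at this
  exact h this

theorem sum_pairPoly_eq {C : Finset (Equiv.Perm V)}
    (hC : ∀ g : Equiv.Perm V, ∀ ω ∈ C, g.permCongr ω ∈ C) (z : ℂ) {a b a' b' : V} (h : a ≠ b)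
    (h' : a' ≠ b') : ∑ ω ∈ C, pairPoly z ω a b = ∑ ω ∈ C, pairPoly z ω a' b' := by
  obtain ⟨g, rfl, rfl⟩ := exists_perm_apply_pair h h'
  refine Finset.sum_equiv g.permCongr (fun ω => ⟨hC g ω, fun hω => ?_⟩) fun ω _ =>
    (pairPoly_permCongr g z ω a b).symm
  have := hC g⁻¹ _ hω
  rwa [show (g⁻¹ : Equiv.Perm V).permCongr (g.permCongr ω) = ω from
    Equiv.symm_apply_apply g.permCongr ω] at this

theorem sum_sum_pairPoly {C : Finset (Equiv.Perm V)}
    (hC : ∀ g : Equiv.Perm V, ∀ ω ∈ C, g.permCongr ω ∈ C) (z : ℂ) {a b : V} (h : a ≠ b) :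
    ∑ ω ∈ C, ∑ x, ∑ y ∈ Finset.univ.erase x, pairPoly z ω x y =
      (Fintype.card V * (Fintype.card V - 1 : ℕ) : ℂ) • ∑ ω ∈ C, pairPoly z ω a b := by
  rw [Finset.sum_comm]
  simp only [Finset.sum_comm (s := C)]
  rw [Finset.sum_congr rfl fun x _ => Finset.sum_congr rfl fun y hy =>
    sum_pairPoly_eq hC z (Finset.ne_of_mem_erase hy).symm h]
  simp [mul_smul, Polynomial.smul_eq_C_mul]

theorem sum_classSum (d : ℕ) {C : Finset (Equiv.Perm (Option (Option (Fin (d + 1)))))} (z : ℂ)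
    (hC : ∀ g : Equiv.Perm (Option (Option (Fin (d + 1)))), ∀ ω ∈ C, g.permCongr ω ∈ C)
    (h2 : ∀ ω ∈ C, ∀ a b, a ≠ b → ω a = b → ω b ≠ a)
    (h1 : ∀ ω ∈ C, ∀ a b, ω a = a → ω b = b → a = b) :
    (d + 3) * (d + 2) * ((d + 1) * (d + 2)) *
      ∑ γ : Equiv.Perm (Fin (d + 1)) with cycleCount γ = 1, ∑ ω ∈ C,
        z ^ cycleCount (ω * (Equiv.swap none (some none) *
          Equiv.optionCongr (Equiv.optionCongr γ))) =
      ∑ ω ∈ C, ((d + 2) * z * ((z + 1) * pochSum (d + 1) (z + d + 2) (cyclePoly ω) +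
        (z - 1) * pochSum (d + 1) (z + d + 1) (cyclePoly ω)) +
      2 * z * ((d + 3 : ℕ) - ω.support.card : ℂ) *
        pochSum (d + 2) (z + d + 2) (cyclePoly ω)) := by
  have hcard : Fintype.card (Option (Option (Fin (d + 1)))) = d + 3 := by simp
  have h := congrArg (pochSum (d + 2) (z + d + 1))
    (sum_sum_pairPoly hC z (a := none) (b := some none) (by simp))
  rw [hcard, map_smul, map_sum, map_sum, Finset.sum_congr rfl fun ω hω =>
    (card_mul_sum_fullCycle d z (h2 ω hω) (h1 ω hω)).symm, ← Finset.mul_sum, Finset.sum_comm,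
    Finset.sum_congr rfl fun ω _ => pochSum_sum_pairPoly d hcard z ω, hcard] at h
  rw [h, smul_eq_mul]
  push_cast
  ring

end Averaging

section Zeros

theorem norm_eval_lt_norm_eval {q : ℂ[X]} {c : ℝ} (hq : q ≠ 0)
    (hc : ∀ z, q.eval z = 0 → z.re = c) {v w : ℂ} (him : w.im = v.im)
    (hre : |v.re - c| < |w.re - c|) :
    q.eval w ≠ 0 ∧ ‖q.eval v‖ ≤ ‖q.eval w‖ ∧ (q.natDegree ≠ 0 → ‖q.eval v‖ < ‖q.eval w‖) := by
  have hne : q.eval w ≠ 0 := fun h => by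
    rw [hc w h, sub_self, abs_zero] at hre
    exact absurd hre (abs_nonneg _).not_gt
  refine ⟨hne, ?_⟩
  have hroot : ∀ ρ ∈ q.roots, ‖v - ρ‖ < ‖w - ρ‖ := fun ρ hρ => by
    have hρc := hc ρ (Polynomial.isRoot_of_mem_roots hρ)
    rw [← sq_lt_sq₀ (norm_nonneg _) (norm_nonneg _), ← Complex.normSq_eq_norm_sq,
      ← Complex.normSq_eq_norm_sq, Complex.normSq_apply, Complex.normSq_apply]
    have := sq_lt_sq.2 hre
    simp only [Complex.sub_re, Complex.sub_im, hρc, him]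
    nlinarith
  have heval (x : ℂ) : ‖q.eval x‖ =
      ‖q.leadingCoeff‖ * (q.roots.map fun ρ => ‖x - ρ‖).prod := by
    conv_lhs => rw [(IsAlgClosed.splits q).eq_prod_roots]
    rw [Polynomial.eval_mul, Polynomial.eval_C, norm_mul, Polynomial.eval_multiset_prod,
      Multiset.map_map]
    congr 1
    refine (map_multiset_prod (normHom : ℂ →*₀ ℝ) _).trans ?_
    rw [Multiset.map_map]
    simp
  have hpos : 0 < ‖q.leadingCoeff‖ := by simpa using hq
  have hlt (hd : q.natDegree ≠ 0) : ‖q.eval v‖ < ‖q.eval w‖ := by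
    by_cases hv : q.eval v = 0
    · rw [hv, norm_zero]
      exact norm_pos_iff.2 hne
    · rw [heval, heval]
      refine mul_lt_mul_of_pos_left (Multiset.prod_map_lt_prod_map ?_ _ _ (fun ρ hρ => ?_) hroot)
        hpos
      · rw [(IsAlgClosed.splits q).natDegree_eq_card_roots] at hd
        simpa using hd
      · rw [norm_pos_iff, sub_ne_zero]
        rintro rfl
        exact hv (Polynomial.isRoot_of_mem_roots hρ)
  refine ⟨?_, hlt⟩
  by_cases hd : q.natDegree = 0
  · rw [Polynomial.eq_C_of_natDegree_eq_zero hd, Polynomial.eval_C, Polynomial.eval_C]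
  · exact (hlt hd).le

theorem norm_lt_norm_of_abs_re_lt {v w : ℂ} (him : w.im = v.im) (hre : |v.re| < |w.re|) :
    ‖v‖ < ‖w‖ := by
  have h := (norm_eval_lt_norm_eval (c := 0) (Polynomial.X_ne_zero (R := ℂ))
    (fun z hz => by simpa using congrArg Complex.re hz) him (by simpa using hre)).2.2 (by simp)
  simpa using h

theorem mul_eval_ne_mul_eval {q : ℂ[X]} {c : ℝ} (hq : q ≠ 0)
    (hc : ∀ z, q.eval z = 0 → z.re = c) {v w : ℂ} (him : w.im = v.im)
    (hre : |v.re - c| < |w.re - c|) {p s : ℂ} (h : ‖s‖ < ‖p‖) :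
    p * q.eval w ≠ s * q.eval v := fun heq => by
  obtain ⟨h1, h2, -⟩ := norm_eval_lt_norm_eval hq hc him hre
  have h3 := congrArg norm heq
  rw [norm_mul, norm_mul] at h3
  have h4 := mul_lt_mul_of_pos_right h (norm_pos_iff.2 h1)
  have h5 := mul_le_mul_of_nonneg_left h2 (norm_nonneg s)
  linarith

theorem re_eq_of_step {q : ℂ[X]} {N j : ℕ} (hj : j < N) {ζ : ℂ} (hζ : ‖ζ‖ = 1) (hq : q ≠ 0)
    (hc : ∀ z, q.eval z = 0 → z.re = ((N : ℝ) - 1 + j) / 2) {z : ℂ}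
    (h : (z - j) * q.eval z - ζ * (z - N) * q.eval (z - 1) = 0) :
    z.re = ((N : ℝ) - 1 + (j + 1 : ℕ)) / 2 := by
  have hjN : (j : ℝ) < N := by exact_mod_cast hj
  have hζN (x : ℂ) : ‖ζ * x‖ = ‖x‖ := by rw [norm_mul, hζ, one_mul]
  push_cast
  by_contra hne
  rcases lt_or_gt_of_ne hne with hlt | hgt
  · refine mul_eval_ne_mul_eval hq hc (v := z) (w := z - 1) (by simp) ?_ ?_ (sub_eq_zero.1 h).symm
    · rw [← sq_lt_sq, Complex.sub_re, Complex.one_re]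
      nlinarith
    · rw [hζN]
      refine norm_lt_norm_of_abs_re_lt (by simp) ?_
      rw [← sq_lt_sq, Complex.sub_re, Complex.sub_re, Complex.natCast_re, Complex.natCast_re]
      nlinarith
  · refine mul_eval_ne_mul_eval hq hc (v := z - 1) (w := z) (by simp) ?_ ?_ (sub_eq_zero.1 h)
    · rw [← sq_lt_sq, Complex.sub_re, Complex.one_re]
      nlinarith
    · rw [hζN]
      refine norm_lt_norm_of_abs_re_lt (by simp) ?_
      rw [← sq_lt_sq, Complex.sub_re, Complex.sub_re, Complex.natCast_re, Complex.natCast_re]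
      nlinarith

theorem re_eq_of_eval_sub {q : ℂ[X]} {c : ℝ} {ζ : ℂ} (hζ : ‖ζ‖ = 1) (hd : q.natDegree ≠ 0)
    (hc : ∀ z, q.eval z = 0 → z.re = c) {z : ℂ} (h : q.eval z - ζ * q.eval (z - 1) = 0) :
    z.re = c + 1 / 2 := by
  have hq : q ≠ 0 := by
    rintro rfl
    simp at hd
  have h' : ‖q.eval z‖ = ‖q.eval (z - 1)‖ := by
    rw [sub_eq_zero.1 h, norm_mul, hζ, one_mul]
  by_contra hne
  rcases lt_or_gt_of_ne hne with hlt | hgt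
  · refine ((norm_eval_lt_norm_eval hq hc (v := z) (w := z - 1) (by simp) ?_).2.2 hd).ne h'
    rw [← sq_lt_sq, Complex.sub_re, Complex.one_re]
    nlinarith
  · refine ((norm_eval_lt_norm_eval hq hc (v := z - 1) (w := z) (by simp) ?_).2.2 hd).ne' h'
    rw [← sq_lt_sq, Complex.sub_re, Complex.one_re]
    nlinarith

theorem pochSum_one_sub_C_mul_X_mul (d : ℕ) (s ζ : ℂ) (G : ℂ[X]) :
    pochSum d s ((1 - Polynomial.C ζ * Polynomial.X) * G) =
      pochSum d s G - ζ * pochSum d (s - 1) G := by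
  rw [sub_mul, one_mul, mul_assoc, map_sub, pochSum_C_mul, pochSum_X_mul]

theorem exists_pochSum_prod_eq (N : ℕ) (L : Multiset ℂ) (hL : ∀ ζ ∈ L, ‖ζ‖ = 1) :
    ∃ q : ℂ[X], (∀ z, pochSum N z (L.map fun ζ => 1 - Polynomial.C ζ * Polynomial.X).prod =
        (descPochhammer ℂ (N - L.card)).eval (z - L.card) * q.eval z) ∧
      (q ≠ 0 → ∀ z, q.eval z = 0 → z.re = ((N : ℝ) - 1 + L.card) / 2) := by
  induction L using Multiset.induction_on with
  | empty =>
    refine ⟨1, fun z => ?_, by simp⟩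
    rw [Multiset.map_zero, Multiset.prod_zero, ← Polynomial.monomial_zero_one, pochSum_monomial]
    simp
  | cons ζ L ih =>
    obtain ⟨q, hF, hz⟩ := ih fun ξ hξ => hL ξ (Multiset.mem_cons_of_mem hξ)
    have hζ := hL ζ (Multiset.mem_cons_self ζ L)
    simp only [Multiset.map_cons, Multiset.prod_cons, pochSum_one_sub_C_mul_X_mul, hF,
      Multiset.card_cons]
    rcases lt_or_ge L.card N with hj | hj
    · obtain ⟨m, hm⟩ : ∃ m, N - L.card = m + 1 := ⟨N - L.card - 1, by omega⟩
      refine ⟨(Polynomial.X - Polynomial.C (L.card : ℂ)) * q -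
        Polynomial.C ζ * (Polynomial.X - Polynomial.C (N : ℂ)) *
          q.comp (Polynomial.X - Polynomial.C 1), fun z => ?_, fun h0 z h => ?_⟩
      · have h1 := eval_descPochhammer_succ_left m (z - L.card - 1)
        rw [sub_add_cancel] at h1
        rw [show N - (L.card + 1) = m by omega, hm, h1, descPochhammer_succ_eval]
        have hN : (N : ℂ) = m + 1 + L.card := by
          exact_mod_cast (by omega : N = m + 1 + L.card)
        simp only [Polynomial.eval_sub, Polynomial.eval_mul, Polynomial.eval_X, Polynomial.eval_C,
          Polynomial.eval_comp, hN]
        push_cast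
        rw [show z - (L.card + 1) = z - L.card - 1 by ring,
          show z - 1 - L.card = z - L.card - 1 by ring]
        ring
      · have hq : q ≠ 0 := by
          rintro rfl
          simp at h0
        exact re_eq_of_step hj hζ hq (hz hq) (by simpa using h)
    · rw [Nat.sub_eq_zero_of_le hj, Nat.sub_eq_zero_of_le (by omega)]
      refine ⟨q - Polynomial.C ζ * q.comp (Polynomial.X - Polynomial.C 1), fun z => by simp,
        fun h0 z h => ?_⟩
      by_cases hd : q.natDegree = 0
      · rw [Polynomial.eq_C_of_natDegree_eq_zero hd] at h h0
        refine absurd ?_ h0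
        rw [Polynomial.C_comp, ← map_mul, ← map_sub] at h ⊢
        rwa [Polynomial.eval_C, ← map_eq_zero_iff _ Polynomial.C_injective] at h
      · have hq : q ≠ 0 := by
          rintro rfl
          simp at hd
        rw [re_eq_of_eval_sub hζ hd (hz hq) (by simpa using h)]
        push_cast
        ring

theorem exists_cyclePoly_eq_prod {V : Type*} [Fintype V] [DecidableEq V] (ω : Equiv.Perm V) :
    ∃ L : Multiset ℂ, L.card = Fintype.card V ∧ (∀ ζ ∈ L, ‖ζ‖ = 1) ∧
      cyclePoly ω = (L.map fun ζ => 1 - Polynomial.C ζ * Polynomial.X).prod := by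
  set M : Matrix V V ℂ := Matrix.of fun i j => if ω i = j then 1 else 0 with hM
  have hsplit := (IsAlgClosed.splits M.charpoly)
  refine ⟨M.charpoly.roots, ?_, fun ζ hζ => ?_, ?_⟩
  · rw [← hsplit.natDegree_eq_card_roots, Matrix.charpoly_natDegree_eq_dim]
  · have h0 := Polynomial.isRoot_of_mem_roots hζ
    rw [Polynomial.IsRoot, Matrix.eval_charpoly, ← Matrix.exists_mulVec_eq_zero_iff] at h0
    obtain ⟨v, hv, h⟩ := h0
    have hpt (i : V) : v (ω i) = ζ * v i := by
      have := congrFun h i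
      rw [Matrix.sub_mulVec, Pi.sub_apply, Pi.zero_apply, sub_eq_zero] at this
      simpa [hM, Matrix.mulVec, dotProduct, Matrix.diagonal_apply] using this.symm
    have hsum : ∑ i, ‖v i‖ = ‖ζ‖ * ∑ i, ‖v i‖ := by
      rw [Finset.mul_sum, ← Equiv.sum_comp ω]
      exact Finset.sum_congr rfl fun i _ => by rw [hpt, norm_mul]
    have hne : ∑ i, ‖v i‖ ≠ 0 := fun h0 => hv <| funext fun i => by
      simpa using (Finset.sum_eq_zero_iff_of_nonneg fun i _ => norm_nonneg (v i)).1 h0 i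
        (Finset.mem_univ i)
    exact (mul_right_cancel₀ hne (hsum.symm.trans (one_mul _).symm))
  · have h1 : cyclePoly ω = M.charpoly.reverse := by
      rw [Matrix.reverse_charpoly, Matrix.charpolyRev, cyclePoly, weightDet]
      congr 1
      ext1 i j
      by_cases h : ω i = j <;> simp [weightMatrix, hM, Matrix.one_apply, h]
    have h2 (s : Multiset ℂ) : ((s.map fun ζ => Polynomial.X - Polynomial.C ζ).prod).reverse =
        (s.map fun ζ => 1 - Polynomial.C ζ * Polynomial.X).prod := by
      induction s using Multiset.induction_on with
      | empty => exact Polynomial.reverse_C 1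
      | cons ζ s ih =>
        rw [Multiset.map_cons, Multiset.prod_cons, Polynomial.reverse_mul_of_domain, ih,
          Multiset.map_cons, Multiset.prod_cons]
        congr 1
        have := Polynomial.reverse_mul_X (1 : ℂ[X])
        rw [one_mul, ← Polynomial.C_1, Polynomial.reverse_C, Polynomial.C_1] at this
        rw [sub_eq_add_neg, ← map_neg, Polynomial.reverse_add_C, this, Polynomial.natDegree_X,
          pow_one, map_neg, neg_mul, sub_eq_add_neg]
    rw [h1, ← h2, ← hsplit.eq_prod_roots_of_monic M.charpoly_monic]

end Zeros

section MainArgument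

theorem re_eq_zero_of_card_add_two {N : ℕ} {L : Multiset ℂ} (hL : ∀ ζ ∈ L, ‖ζ‖ = 1)
    (hcard : L.card = N + 2) {H : ℂ[X]}
    (hH : H = (L.map fun ζ => 1 - Polynomial.C ζ * Polynomial.X).prod)
    (hne : ∃ x, pochSum N x H ≠ 0) {z : ℂ}
    (h : (z + 1) * pochSum N (z + N + 1) H + (z - 1) * pochSum N (z + N) H = 0) : z.re = 0 := by
  obtain ⟨q, hq, hz⟩ := exists_pochSum_prod_eq N L hL
  rw [← hH] at hq
  simp only [hcard, show N - (N + 2) = 0 by omega, descPochhammer_zero, Polynomial.eval_one,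
    one_mul] at hq
  simp only [hq] at h hne
  obtain ⟨x, hx⟩ := hne
  have hq0 : q ≠ 0 := fun h0 => hx (by simp [h0])
  have hz' := hz hq0
  rw [hcard] at hz'
  push_cast at hz'
  have h' : (z + 1) * q.eval (z + N + 1) = (1 - z) * q.eval (z + N) := by
    linear_combination h
  by_contra hre
  rcases lt_or_gt_of_ne hre with hlt | hgt
  · refine mul_eval_ne_mul_eval hq0 hz' (by simp) ?_ ?_ h'.symm
    · rw [← sq_lt_sq]
      simp
      nlinarith
    · rw [norm_sub_rev]
      refine norm_lt_norm_of_abs_re_lt (by simp) ?_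
      rw [← sq_lt_sq]
      simp
      nlinarith
  · refine mul_eval_ne_mul_eval hq0 hz' (by simp) ?_ ?_ h'
    · rw [← sq_lt_sq]
      simp
      nlinarith
    · rw [norm_sub_rev]
      refine norm_lt_norm_of_abs_re_lt (by simp) ?_
      rw [← sq_lt_sq]
      simp
      nlinarith

theorem re_eq_zero_of_card_add_one {N : ℕ} {L : Multiset ℂ} (hL : ∀ ζ ∈ L, ‖ζ‖ = 1)
    (hcard : L.card = N + 1) {H : ℂ[X]}
    (hH : H = (L.map fun ζ => 1 - Polynomial.C ζ * Polynomial.X).prod)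
    (hne : ∃ x, pochSum N x H ≠ 0) {z : ℂ}
    (h : (z + 1) * pochSum N (z + N + 1) H - (z - 1) * pochSum N (z + N - 1) H = 0) :
    z.re = 0 := by
  obtain ⟨q, hq, hz⟩ := exists_pochSum_prod_eq N L hL
  rw [← hH] at hq
  simp only [hcard, show N - (N + 1) = 0 by omega, descPochhammer_zero, Polynomial.eval_one,
    one_mul] at hq
  simp only [hq] at h hne
  obtain ⟨x, hx⟩ := hne
  have hq0 : q ≠ 0 := fun h0 => hx (by simp [h0])
  have hz' := hz hq0
  rw [hcard] at hz'
  push_cast at hz'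
  have h' := sub_eq_zero.1 h
  by_contra hre
  rcases lt_or_gt_of_ne hre with hlt | hgt
  · refine mul_eval_ne_mul_eval hq0 hz' (by simp) ?_ ?_ h'.symm
    · rw [← sq_lt_sq]
      simp
      nlinarith
    · refine norm_lt_norm_of_abs_re_lt (by simp) ?_
      rw [← sq_lt_sq]
      simp
      nlinarith
  · refine mul_eval_ne_mul_eval hq0 hz' (by simp) ?_ ?_ h'
    · rw [← sq_lt_sq]
      simp
      nlinarith
    · refine norm_lt_norm_of_abs_re_lt (by simp) ?_
      rw [← sq_lt_sq]
      simp
      nlinarith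

theorem apply_apply_ne_of_two_notMem {V : Type*} [Fintype V] [DecidableEq V] {ω : Equiv.Perm V}
    (h : 2 ∉ ω.cycleType) {a b : V} (hab : a ≠ b) (hωa : ω a = b) : ω b ≠ a := fun hωb => by
  have ha : ω a ≠ a := by rw [hωa]; exact hab.symm
  have hc := Equiv.Perm.isCycle_cycleOf ω ha
  have hsq : ω.cycleOf a ^ 2 = 1 := by
    rw [hc.pow_eq_one_iff' (x := a) (by simpa using ha), Equiv.Perm.cycleOf_pow_apply_self]
    simp [pow_two, hωa, hωb]
  have hord : orderOf (ω.cycleOf a) = 2 := orderOf_eq_prime hsq hc.ne_one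
  refine h ?_
  rw [Equiv.Perm.cycleType_def, Multiset.mem_map]
  exact ⟨ω.cycleOf a, Equiv.Perm.cycleOf_mem_cycleFactorsFinset_iff.2 (by simpa using ha), by
    rw [Function.comp_apply, ← hc.orderOf, hord]⟩

theorem eq_of_apply_eq_self {V : Type*} [Fintype V] [DecidableEq V] {ω : Equiv.Perm V}
    (h : Fintype.card V ≤ ω.support.card + 1) {a b : V} (ha : ω a = a) (hb : ω b = b) : a = b := by
  by_contra hab
  have h1 : insert a (insert b ω.support) ⊆ Finset.univ := Finset.subset_univ _
  have h2 := Finset.card_le_card h1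
  rw [Finset.card_insert_of_notMem (by simp [hab, ha]), Finset.card_insert_of_notMem (by simp [hb]),
    Finset.card_univ] at h2
  omega

theorem cycleType_swap_mul_optionCongr {U : Type*} [Fintype U] [DecidableEq U]
    (hU : 2 ≤ Fintype.card U) {γ : Equiv.Perm U} (hγ : cycleCount γ = 1) :
    (Equiv.swap none (some none) *
      Equiv.optionCongr (Equiv.optionCongr γ) : Equiv.Perm (Option (Option U))).cycleType =
      {2, Fintype.card U} := by
  rw [Equiv.Perm.Disjoint.cycleType_mul, cycleType_optionCongr, cycleType_optionCongr,
    cycleType_eq_of_cycleCount_eq_one hU hγ, Equiv.Perm.isSwap_iff_cycleType.1 ⟨none, some none, by simp, rfl⟩]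
  · rfl
  · rintro (_ | _ | x)
    · right; rfl
    · right; rfl
    · left; exact Equiv.swap_apply_of_ne_of_ne (by simp) (by simp)

theorem exists_cycleCount_eq_one (d : ℕ) : ∃ γ : Equiv.Perm (Fin (d + 1)), cycleCount γ = 1 := by
  cases d with
  | zero => exact ⟨1, by simp [cycleCount]⟩
  | succ d =>
    refine ⟨finRotate (d + 2), ?_⟩
    simp [cycleCount, cycleType_finRotate, support_finRotate]

theorem card_mul_sum_cycleCount (d : ℕ) (hd : 1 ≤ d) {m : Multiset ℕ} (hm2 : 2 ∉ m)
    (hm : d + 2 ≤ m.sum) {α ω : Equiv.Perm (Option (Option (Fin (d + 1))))}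
    (hα : α.cycleType = {2, d + 1}) (hω : ω.cycleType = m) (z : ℂ) :
    (d + 3) * (d + 2) * ((d + 1) * (d + 2)) *
      ((Finset.univ.filter fun γ : Equiv.Perm (Fin (d + 1)) => cycleCount γ = 1).card *
        ∑ σ : Equiv.Perm (Option (Option (Fin (d + 1)))) with σ.cycleType = m,
          z ^ cycleCount (σ * α)) =
      (Finset.univ.filter fun σ : Equiv.Perm (Option (Option (Fin (d + 1)))) =>
        σ.cycleType = m).card *
      ((d + 2) * z * ((z + 1) * pochSum (d + 1) (z + d + 2) (cyclePoly ω) +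
        (z - 1) * pochSum (d + 1) (z + d + 1) (cyclePoly ω)) +
      2 * z * ((d + 3 : ℕ) - (m.sum : ℂ)) * pochSum (d + 2) (z + d + 2) (cyclePoly ω)) := by
  have hsupp {σ : Equiv.Perm (Option (Option (Fin (d + 1))))} (hσ : σ.cycleType = m) :
      σ.support.card = m.sum := by
    rw [← Equiv.Perm.sum_cycleType, hσ]
  have h := sum_classSum d z (C := Finset.univ.filter fun σ => σ.cycleType = m)
    (fun g σ hσ => by
      rw [Finset.mem_filter] at hσ ⊢
      rw [cycleType_permCongr]
      exact ⟨Finset.mem_univ _, hσ.2⟩)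
    (fun σ hσ a b hab h1 => by
      rw [Finset.mem_filter] at hσ
      exact apply_apply_ne_of_two_notMem (hσ.2.symm ▸ hm2) hab h1)
    (fun σ hσ a b => by
      rw [Finset.mem_filter] at hσ
      refine eq_of_apply_eq_self ?_
      rw [hsupp hσ.2]
      simp
      omega)
  have hleft (γ : Equiv.Perm (Fin (d + 1))) (hγ : cycleCount γ = 1) :
      ∑ σ : Equiv.Perm (Option (Option (Fin (d + 1)))) with σ.cycleType = m,
        z ^ cycleCount (σ * (Equiv.swap none (some none) *
          Equiv.optionCongr (Equiv.optionCongr γ))) =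
      ∑ σ : Equiv.Perm (Option (Option (Fin (d + 1)))) with σ.cycleType = m,
          z ^ cycleCount (σ * α) := by
    obtain ⟨g, hg⟩ := isConj_iff.1 (Equiv.Perm.isConj_iff_cycleType_eq.2
      ((cycleType_swap_mul_optionCongr (by simpa using hd) hγ).trans
        ((by rw [hα, Fintype.card_fin] : _ = α.cycleType))))
    refine Finset.sum_equiv g.permCongr (fun σ => by simp) fun σ _ => ?_
    rw [← hg, ← Equiv.permCongr_eq_mul, ← Equiv.permCongr_mul, cycleCount_permCongr]
  rw [Finset.sum_congr rfl fun γ hγ => hleft γ (Finset.mem_filter.1 hγ).2, Finset.sum_const,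
    nsmul_eq_mul] at h
  rw [h, ← nsmul_eq_mul, ← Finset.sum_const]
  refine Finset.sum_congr rfl fun σ hσ => ?_
  have hσ' := (Finset.mem_filter.1 hσ).2
  obtain ⟨g, hg⟩ := isConj_iff.1 (Equiv.Perm.isConj_iff_cycleType_eq.2 (hσ'.trans hω.symm))
  rw [← Equiv.permCongr_eq_mul] at hg
  rw [← hg, cyclePoly_permCongr, hsupp hσ']

theorem re_eq_zero_of_sum_cycleCount (d : ℕ) (hd : 1 ≤ d) {m : Multiset ℕ} (hm2 : 2 ∉ m)
    (hm : m.sum = d + 2 ∨ m.sum = d + 3) {α ω : Equiv.Perm (Option (Option (Fin (d + 1))))}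
    (hα : α.cycleType = {2, d + 1}) (hω : ω.cycleType = m) {z : ℂ}
    (hz : ∑ σ : Equiv.Perm (Option (Option (Fin (d + 1)))) with σ.cycleType = m,
      z ^ cycleCount (σ * α) = 0) : z.re = 0 := by
  have key := card_mul_sum_cycleCount d hd hm2 (by omega) hα hω
  set B : ℂ → ℂ := fun z => (d + 2) * z * ((z + 1) * pochSum (d + 1) (z + d + 2) (cyclePoly ω) +
        (z - 1) * pochSum (d + 1) (z + d + 1) (cyclePoly ω)) +
      2 * z * ((d + 3 : ℕ) - (m.sum : ℂ)) * pochSum (d + 2) (z + d + 2) (cyclePoly ω) with hB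
  have hC : ((Finset.univ.filter fun σ : Equiv.Perm (Option (Option (Fin (d + 1)))) =>
        σ.cycleType = m).card : ℂ) ≠ 0 := by
    rw [Nat.cast_ne_zero]
    exact Finset.card_ne_zero_of_mem (Finset.mem_filter.2 ⟨Finset.mem_univ ω, hω⟩)
  have hcyc : ((Finset.univ.filter fun γ : Equiv.Perm (Fin (d + 1)) =>
      cycleCount γ = 1).card : ℂ) ≠ 0 := by
    obtain ⟨γ, hγ⟩ := exists_cycleCount_eq_one d
    rw [Nat.cast_ne_zero]
    exact Finset.card_ne_zero_of_mem (Finset.mem_filter.2 ⟨Finset.mem_univ γ, hγ⟩)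
  have h1 : (d + 1 : ℂ) ≠ 0 := by exact_mod_cast d.succ_ne_zero
  have h2 : (d + 2 : ℂ) ≠ 0 := by exact_mod_cast (d + 1).succ_ne_zero
  have h3 : (d + 3 : ℂ) ≠ 0 := by exact_mod_cast (d + 2).succ_ne_zero
  have hBz : B z = 0 := by
    have h := key z
    rw [hz, mul_zero, mul_zero] at h
    exact (mul_eq_zero.1 h.symm).resolve_left hC
  have hB1 : B 1 ≠ 0 := fun h0 => by
    have h := key 1
    change _ = _ * B 1 at h
    simp only [h0, one_pow, Finset.sum_const, nsmul_eq_mul, mul_one, mul_zero] at h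
    exact mul_ne_zero (mul_ne_zero (mul_ne_zero h3 h2) (mul_ne_zero h1 h2))
      (mul_ne_zero hcyc hC) h
  by_cases hz0 : z = 0
  · rw [hz0, Complex.zero_re]
  obtain ⟨L, hLcard, hL, hprod⟩ := exists_cyclePoly_eq_prod ω
  rw [Fintype.card_option, Fintype.card_option, Fintype.card_fin] at hLcard
  rcases hm with hm | hm
  · obtain ⟨K, hK, -⟩ := exists_cyclePoly_quotient ω
    have hone : (1 : ℂ) ∈ L := by
      have h := congrArg (Polynomial.eval 1) (hK.trans hprod)
      rw [Polynomial.eval_mul, Polynomial.eval_multiset_prod, Multiset.map_map] at h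
      simp only [Polynomial.eval_sub, Polynomial.eval_one, Polynomial.eval_X, sub_self, zero_mul]
        at h
      obtain ⟨ζ, hζ, h⟩ := Multiset.mem_map.1 (Multiset.prod_eq_zero_iff.1 h.symm)
      rwa [show (1 : ℂ) = ζ by simpa [sub_eq_zero] using h]
    set G := ((L.erase 1).map fun ζ => 1 - Polynomial.C ζ * Polynomial.X).prod with hG
    have hHG : cyclePoly ω = (1 - Polynomial.X) * G := by
      rw [hprod, ← Multiset.cons_erase hone, Multiset.map_cons, Multiset.prod_cons,
        Polynomial.C_1, one_mul]
    have hBG (x : ℂ) : B x = (d + 2) * x * ((x + 1) * pochSum (d + 1) (x + (d + 1 : ℕ) + 1) G -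
        (x - 1) * pochSum (d + 1) (x + (d + 1 : ℕ) - 1) G) := by
      have e1 := pochSum_one_sub_X_mul (d + 1) (x + (d + 1)) G
      have e2 (s : ℂ) : pochSum (d + 1) s ((1 - Polynomial.X) * G) =
          pochSum (d + 1) s G - pochSum (d + 1) (s - 1) G := by
        rw [sub_mul, one_mul, map_sub, pochSum_X_mul]
      simp only [hB, hHG, e2, hm]
      rw [show x + (d + 1) + 1 = x + d + 2 by ring] at e1
      push_cast at e1 ⊢
      rw [e1, show x + d + 2 - 1 = x + (d + 1) by ring,
        show x + d + 1 - 1 = x + (d + 1) - 1 by ring, show x + d + 1 = x + (d + 1) by ring,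
        show x + d + 2 = x + (d + 1) + 1 by ring]
      ring
    refine re_eq_zero_of_card_add_one (N := d + 1) (fun ζ hζ => hL ζ (Multiset.mem_of_mem_erase hζ))
      (by rw [Multiset.card_erase_of_mem hone, hLcard]; rfl) hG ?_ (z := z) ?_
    · by_contra! h0
      exact hB1 (by rw [hBG, h0, h0]; ring)
    · rw [hBG] at hBz
      exact (mul_eq_zero.1 hBz).resolve_left (mul_ne_zero h2 hz0)
  · have hBH (x : ℂ) : B x = (d + 2) * x * ((x + 1) * pochSum (d + 1) (x + (d + 1 : ℕ) + 1)
        (cyclePoly ω) + (x - 1) * pochSum (d + 1) (x + (d + 1 : ℕ)) (cyclePoly ω)) := by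
      simp only [hB, hm]
      push_cast
      rw [show x + d + 2 = x + (d + 1) + 1 by ring, show x + d + 1 = x + (d + 1) by ring]
      ring
    refine re_eq_zero_of_card_add_two hL (N := d + 1) hLcard hprod ?_ (z := z) ?_
    · by_contra! h0
      exact hB1 (by rw [hBH, h0, h0]; ring)
    · rw [hBH] at hBz
      exact (mul_eq_zero.1 hBz).resolve_left (mul_ne_zero h2 hz0)

end MainArgument

section FullCycleType

theorem fullCycleType_eq_iff {n : ℕ} {β : Multiset ℕ} (hsum : β.sum = n) (hβ : ∀ b ∈ β, 1 ≤ b)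
    (σ : Equiv.Perm (Fin n)) : fullCycleType σ = β ↔ σ.cycleType = β.filter (2 ≤ ·) := by
  have hσ : (σ.cycleType).filter (2 ≤ ·) = σ.cycleType :=
    Multiset.filter_eq_self.2 fun a ha => Equiv.Perm.two_le_of_mem_cycleType ha
  unfold fullCycleType
  constructor
  · rintro rfl
    rw [Multiset.filter_add, hσ, Multiset.filter_eq_nil.2, add_zero]
    intro a ha
    rw [Multiset.eq_of_mem_replicate ha]
    omega
  · intro h
    have hones : β.filter (fun b => ¬ 2 ≤ b) = Multiset.replicate
        (Multiset.card (β.filter (fun b => ¬ 2 ≤ b))) 1 := by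
      refine Multiset.eq_replicate_card.2 fun b hb => ?_
      obtain ⟨hb, hb'⟩ := Multiset.mem_filter.1 hb
      have := hβ b hb
      omega
    have hsplit := Multiset.filter_add_not (2 ≤ ·) β
    have hsum' := congrArg Multiset.sum hsplit
    rw [Multiset.sum_add, hones, Multiset.sum_replicate, smul_eq_mul, mul_one, hsum, ← h] at hsum'
    rw [show n - σ.cycleType.sum = Multiset.card (β.filter (fun b => ¬ 2 ≤ b)) by omega, ← hones, h,
      hsplit]

theorem aeval_Pperm {n : ℕ} {α : Equiv.Perm (Fin n)} {β : Multiset ℕ} (z : ℂ) :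
    Polynomial.aeval z (Pperm α β) =
      ((n : ℂ) * (n - 1) / (permClass n β).card) *
        ∑ σ ∈ permClass n β, z ^ cycleCount (σ * α) := by
  have hcomm (σ : Equiv.Perm (Fin n)) : numCycles (α * σ) = cycleCount (σ * α) := by
    rw [numCycles_eq_cycleCount, ← cycleCount_conj (σ * α) α, mul_assoc, mul_inv_cancel_right]
  simp [Pperm, hcomm]

theorem re_eq_zero_of_aeval_Pperm {n : ℕ} (hn : 4 ≤ n) {β : Multiset ℕ} (hsum : β.sum = n)
    (hβ : ∀ b ∈ β, 1 ≤ b) (h2 : 2 ∉ β)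
    (hm : (β.filter (2 ≤ ·)).sum = n - 1 ∨ (β.filter (2 ≤ ·)).sum = n) {α : Equiv.Perm (Fin n)}
    (hα : fullCycleType α = {2, n - 2}) {z : ℂ} (hz : Polynomial.aeval z (Pperm α β) = 0) :
    z.re = 0 := by
  obtain ⟨d, rfl⟩ : ∃ d, n = d + 3 := ⟨n - 3, by omega⟩
  set m := β.filter (2 ≤ ·) with hmdef
  have hαc : α.cycleType = {2, d + 1} := by
    rw [show d + 3 - 2 = d + 1 by omega] at hα
    have hle : 2 ≤ d + 1 := by omega
    rw [fullCycleType_eq_iff (by simp; ring) (by simp)] at hα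
    rw [hα, Multiset.filter_eq_self.2]
    simpa using by omega
  have hclass : permClass (d + 3) β = Finset.univ.filter fun σ => σ.cycleType = m :=
    Finset.filter_congr fun σ _ => fullCycleType_eq_iff hsum hβ σ
  obtain ⟨e⟩ : Nonempty (Fin (d + 3) ≃ Option (Option (Fin (d + 1)))) :=
    ⟨Fintype.equivOfCardEq (by simp)⟩
  obtain ⟨ω, hω⟩ := (Equiv.Perm.exists_with_cycleType_iff (Option (Option (Fin (d + 1)))) (m := m)).2
    ⟨by
      simp only [Fintype.card_option, Fintype.card_fin]
      omega, fun a ha => (Multiset.mem_filter.1 ha).2⟩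
  have hcard : ((permClass (d + 3) β).card : ℂ) ≠ 0 := by
    rw [Nat.cast_ne_zero, hclass]
    refine Finset.card_ne_zero_of_mem (a := e.symm.permCongr ω)
      (Finset.mem_filter.2 ⟨Finset.mem_univ _, ?_⟩)
    rw [cycleType_permCongr, hω]
  have hn0 : ((d + 3 : ℕ) : ℂ) * ((d + 3 : ℕ) - 1) ≠ 0 := by
    refine mul_ne_zero (Nat.cast_ne_zero.2 (by omega)) ?_
    rw [sub_ne_zero, Nat.cast_ne_one]
    omega
  rw [aeval_Pperm] at hz
  have hz' := (mul_eq_zero.1 hz).resolve_left (div_ne_zero hn0 hcard)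
  refine re_eq_zero_of_sum_cycleCount d (by omega) (m := m)
    (fun h => h2 (Multiset.mem_of_mem_filter h)) (by omega)
    (α := e.permCongr α) (by rw [cycleType_permCongr, hαc]) hω (z := z) ?_
  rw [← hz', hclass]
  symm
  refine Finset.sum_equiv e.permCongr (fun σ => by simp [cycleType_permCongr]) fun σ _ => ?_
  rw [← Equiv.permCongr_mul, cycleCount_permCongr]

end FullCycleType

/-- all complex zeros of `P_{[2,n−2],β}` are purely imaginary, for `β` with
all parts `≥ 3` or `β = [1, n−1]`. -/
theorem Pperm_imaginary_zeros (n : ℕ) (hn : 6 ≤ n) (β : Multiset ℕ)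
    (hsum : β.sum = n)
    (hβ : (∀ b ∈ β, 3 ≤ b) ∨ β = ({1, n - 1} : Multiset ℕ))
    (α : Equiv.Perm (Fin n)) (hα : fullCycleType α = ({2, n - 2} : Multiset ℕ)) :
    ∀ z : ℂ, Polynomial.aeval z (Pperm α β) = 0 → z.re = 0 := by
  intro z hz
  rcases hβ with hβ | rfl
  · refine re_eq_zero_of_aeval_Pperm (by omega) hsum (fun b hb => by linarith [hβ b hb])
      (fun h => absurd (hβ 2 h) (by omega)) (Or.inr ?_) hα hz
    rwa [Multiset.filter_eq_self.2 fun b hb => by linarith [hβ b hb]]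
  · refine re_eq_zero_of_aeval_Pperm (by omega) hsum ?_ ?_ (Or.inl ?_) hα hz
    · simp
      omega
    · simp
      omega
    · have : 2 ≤ n - 1 := by omega
      rw [Multiset.insert_eq_cons, Multiset.filter_cons_of_neg _ (by omega),
        Multiset.filter_singleton, if_pos this, Multiset.sum_singleton]
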